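/- arXiv:0811.1570 — 5 statements merged into one kernel-verified Lean document; each statement's English description precedes it below -/
import Mathlib

section
/- Subsystem codes from stabilizer codes and conversely: If there exists an [[n,k,d]]_q stabilizer code that is pure to d' (respectively, F_q-linear), then for every r in the range 0 ≤ r < k there exists an [[n, k−r, r, d_r]]_q Clifford subsystem code with d_r ≥ d that is pure to min{d, d'} (respectively, F_q-linear). Conversely, if a pure [[n,k,r,d]]_q Clifford subsystem code exists (respectively, F_q-linear), then a pure [[n, k+r, d]]_q stabilizer code exists (respectively, F_q-linear). -/
open Finset

/-- Symplectic weight of a vector `(a|b) ∈ F_q^n × F_q^n`. -/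
noncomputable def swt {F : Type} [Field F] {n : ℕ} (v : (Fin n → F) × (Fin n → F)) : ℕ :=
  {i : Fin n | ¬(v.1 i = 0 ∧ v.2 i = 0)}.ncard

/-- Minimum symplectic weight of a nonzero element of a set. -/
noncomputable def minSwt {F : Type} [Field F] {n : ℕ} (S : Set ((Fin n → F) × (Fin n → F))) : ℕ :=
  sInf (swt '' (S \ {0}))

/-- The trace-symplectic form on `F_q^{2n}`. -/
noncomputable def trSympForm (p : ℕ) {F : Type} [Field F] [Fintype F] [CharP F p] {n : ℕ}
    (u v : (Fin n → F) × (Fin n → F)) : ZMod p :=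
  letI := ZMod.algebra F p
  Algebra.trace (ZMod p) F (∑ i, (v.1 i * u.2 i - u.1 i * v.2 i))

/-- The trace-symplectic dual of a set of vectors in `F_q^{2n}`. -/
def sympDual (p : ℕ) {F : Type} [Field F] [Fintype F] [CharP F p] {n : ℕ}
    (C : Set ((Fin n → F) × (Fin n → F))) : Set ((Fin n → F) × (Fin n → F)) :=
  {v | ∀ w ∈ C, trSympForm p v w = 0}

/-- `C` (an additive code in `F_q^{2n}`) defines an `((n,K,R,d))_q` Clifford subsystem code. -/
def IsSubsysCode (p : ℕ) {F : Type} [Field F] [Fintype F] [CharP F p] {n : ℕ}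
    (C : AddSubgroup ((Fin n → F) × (Fin n → F))) (K R d : ℕ) : Prop :=
  let Ds : Set ((Fin n → F) × (Fin n → F)) := ↑C ∩ sympDual p ↑C
  Nat.card Ds * (K * R) = Fintype.card F ^ n ∧
  Nat.card C * K = Fintype.card F ^ n * R ∧
  (sympDual p Ds = ↑C → d = minSwt (sympDual p Ds)) ∧
  (sympDual p Ds ≠ ↑C → d = minSwt (sympDual p Ds \ ↑C))

/-- The subsystem code defined by `C` is pure to `d'`. -/
def PureTo {F : Type} [Field F] {n : ℕ}
    (C : AddSubgroup ((Fin n → F) × (Fin n → F))) (d' : ℕ) : Prop :=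
  ∀ v ∈ C, v ≠ 0 → d' ≤ swt v

/-- The subsystem code defined by `C` is `F_q`-linear. -/
def FqLinear {F : Type} [Field F] {n : ℕ}
    (C : AddSubgroup ((Fin n → F) × (Fin n → F))) : Prop :=
  ∀ (a : F), ∀ v ∈ C, a • v ∈ C

/-- Hamming weight.-/
noncomputable def hwt {F : Type} [Field F] {n : ℕ} (v : Fin n → F) : ℕ := {i | v i ≠ 0}.ncard

/-- Minimum Hamming weight of a nonzero element of a set. -/
noncomputable def minHwt {F : Type} [Field F] {n : ℕ} (S : Set (Fin n → F)) : ℕ :=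
  sInf (hwt '' (S \ {0}))

/-- Euclidean dual. -/
def euclDual {F : Type} [Field F] {n : ℕ} (C : Set (Fin n → F)) : Set (Fin n → F) :=
  {x | ∀ y ∈ C, ∑ i, x i * y i = 0}

/-- Hermitian dual (with respect to `x ↦ x^q`). -/
def hermDual (q : ℕ) {K : Type} [Field K] {n : ℕ} (C : Set (Fin n → K)) : Set (Fin n → K) :=
  {x | ∀ y ∈ C, ∑ i, x i ^ q * y i = 0}

/-- Cyclotomic coset of `a` modulo `n` (w.r.t. multiplier `q`). -/
def cycCoset (q n : ℕ) (a : ZMod n) : Set (ZMod n) := {x | ∃ i : ℕ, x = a * (q : ZMod n) ^ i}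

section AbstractForms

open LinearMap (BilinForm)
open Module

theorem aux_finrank_sup_singleton {K V : Type*} [Field K] [AddCommGroup V] [Module K V]
    [FiniteDimensional K V] (W : Submodule K V) (x : V) (hx : x ∉ W) :
    finrank K (W ⊔ Submodule.span K {x} : Submodule K V) = finrank K W + 1 := by
  have h := Submodule.finrank_sup_add_finrank_inf_eq W (Submodule.span K {x})
  have hd : W ⊓ Submodule.span K {x} = ⊥ := by
    rw [Submodule.eq_bot_iff]
    rintro y ⟨hy1, hy2⟩
    obtain ⟨c, rfl⟩ := Submodule.mem_span_singleton.1 hy2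
    by_cases hc : c = 0
    · simp [hc]
    · exact absurd ((W.smul_mem_iff hc).1 hy1) hx
  have hx0 : x ≠ 0 := fun h0 => hx (h0 ▸ W.zero_mem)
  rw [hd, finrank_bot, finrank_span_singleton hx0] at h
  simpa using h

theorem aux_extend {K V : Type*} [Field K] [AddCommGroup V] [Module K V]
    [FiniteDimensional K V] (B : BilinForm K V) (hA : B.IsAlt) (hN : B.Nondegenerate)
    (W : Submodule K V) (hW : W ≤ B.orthogonal W) (R : ℕ) :
    finrank K W + 2 * R ≤ finrank K (B.orthogonal W) →
    ∃ W' : Submodule K V, W ≤ W' ∧ W' ≤ B.orthogonal W ∧ W' ⊓ B.orthogonal W' = W ∧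
      finrank K W' = finrank K W + 2 * R := by
  have hR : B.IsRefl := hA.isRefl
  induction R with
  | zero =>
    intro _
    exact ⟨W, le_rfl, hW, inf_eq_left.2 hW, by simp⟩
  | succ R ih =>
    intro hle
    obtain ⟨U, hWU, hUW, hrad, hfr⟩ := ih (by omega)
    have f1 := LinearMap.BilinForm.finrank_orthogonal hN W
    have f2 := LinearMap.BilinForm.finrank_orthogonal hN U
    have f3 := Submodule.finrank_le W
    have f4 := Submodule.finrank_le U
    have hnle : ¬ B.orthogonal U ≤ W := by
      intro h
      have := Submodule.finrank_mono h
      omega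
    obtain ⟨x, hxU, hxW⟩ := SetLike.not_le_iff_exists.1 hnle
    have hxU' : x ∉ U := fun h => hxW (hrad ▸ ⟨h, hxU⟩)
    have hy : ∃ y ∈ B.orthogonal U, B y x ≠ 0 := by
      by_contra! hcon
      have : x ∈ B.orthogonal (B.orthogonal U) := fun y hy => hcon y hy
      rw [LinearMap.BilinForm.orthogonal_orthogonal hN hR] at this
      exact hxU' this
    obtain ⟨y, hyU, hyx⟩ := hy
    have hxy : B x y ≠ 0 := fun h => hyx (hR _ _ h)
    have hUx : ∀ u ∈ U, B u x = 0 := hxU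
    have hUy : ∀ u ∈ U, B u y = 0 := hyU
    have hyn : y ∉ U ⊔ Submodule.span K {x} := by
      intro h
      obtain ⟨u, hu, z, hz, rfl⟩ := Submodule.mem_sup.1 h
      obtain ⟨c, rfl⟩ := Submodule.mem_span_singleton.1 hz
      apply hyx
      simp [hUx u hu, hA.self_eq_zero]
    have hmem : ∀ v, v ∈ U ⊔ Submodule.span K {x} ⊔ Submodule.span K {y} →
        ∃ u ∈ U, ∃ a b : K, v = u + a • x + b • y := by
      intro v hv
      obtain ⟨t, ht, z, hz, rfl⟩ := Submodule.mem_sup.1 hv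
      obtain ⟨b, rfl⟩ := Submodule.mem_span_singleton.1 hz
      obtain ⟨u, hu, z, hz, rfl⟩ := Submodule.mem_sup.1 ht
      obtain ⟨a, rfl⟩ := Submodule.mem_span_singleton.1 hz
      exact ⟨u, hu, a, b, rfl⟩
    have hUle : U ≤ U ⊔ Submodule.span K {x} ⊔ Submodule.span K {y} :=
      le_sup_left.trans le_sup_left
    have hxin : x ∈ U ⊔ Submodule.span K {x} ⊔ Submodule.span K {y} :=
      Submodule.mem_sup_left (Submodule.mem_sup_right (Submodule.mem_span_singleton_self x))
    have hyin : y ∈ U ⊔ Submodule.span K {x} ⊔ Submodule.span K {y} :=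
      Submodule.mem_sup_right (Submodule.mem_span_singleton_self y)
    refine ⟨U ⊔ Submodule.span K {x} ⊔ Submodule.span K {y}, hWU.trans hUle, ?_, ?_, ?_⟩
    · have hUo : B.orthogonal U ≤ B.orthogonal W := LinearMap.BilinForm.orthogonal_le hWU
      refine sup_le (sup_le hUW ?_) ?_
      · rw [Submodule.span_singleton_le_iff_mem]; exact hUo hxU
      · rw [Submodule.span_singleton_le_iff_mem]; exact hUo hyU
    · apply le_antisymm
      · rintro v ⟨hv, hvo⟩
        obtain ⟨u, hu, a, b, rfl⟩ := hmem v hv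
        have e1 := hvo x hxin
        have e2 := hvo y hyin
        have e3 := hR _ _ (hUx u hu)
        have e4 := hR _ _ (hUy u hu)
        simp [e3, e4, hA.self_eq_zero, hxy, hyx] at e1 e2
        subst e1 e2
        rw [← hrad]
        refine ⟨by simpa using hu, ?_⟩
        simpa using LinearMap.BilinForm.orthogonal_le hUle hvo
      · intro v hv
        have hv' : v ∈ U ⊓ B.orthogonal U := hrad.symm ▸ hv
        refine ⟨hUle hv'.1, ?_⟩
        intro t ht
        obtain ⟨u, hu, a, b, rfl⟩ := hmem t ht
        have e1 : B u v = 0 := hv'.2 u hu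
        have e2 := hR _ _ (hUx v hv'.1)
        have e3 := hR _ _ (hUy v hv'.1)
        simp [e1, e2, e3]
    · rw [aux_finrank_sup_singleton _ _ hyn, aux_finrank_sup_singleton _ _ hxU', hfr]
      ring

theorem aux_replace {K V : Type*} [Field K] [AddCommGroup V] [Module K V]
    [FiniteDimensional K V] (B : BilinForm K V) (hA : B.IsAlt) (hN : B.Nondegenerate)
    (wt : V → ℕ) (hsub : ∀ a b, wt (a - b) ≤ wt a + wt b)
    (D : Submodule K V) (hD : D ≤ B.orthogonal D) (d : ℕ)
    (hd1 : ∀ x ∈ B.orthogonal D, x ≠ 0 → d ≤ wt x)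
    (hd2 : ∀ x ∈ B.orthogonal D, x ∉ D → d + 1 ≤ wt x)
    (hne : ¬ B.orthogonal D ≤ D)
    (v : V) (hv : v ∈ D)
    (e : V) (hev : B v e ≠ 0) (he : ∀ c : K, wt (c • e) ≤ 1) :
    ∃ S : Submodule K V, S ≤ B.orthogonal S ∧ finrank K S = finrank K D ∧
      v ∈ B.orthogonal S ∧ v ∉ S ∧ ∀ x ∈ B.orthogonal S, x ≠ 0 → d ≤ wt x := by
  have hR : B.IsRefl := hA.isRefl
  obtain ⟨w, hwo, hwD⟩ := SetLike.not_le_iff_exists.1 hne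
  have hu : ∃ u ∈ B.orthogonal D, B u w ≠ 0 := by
    by_contra! hcon
    have : w ∈ B.orthogonal (B.orthogonal D) := fun y hy => hcon y hy
    rw [LinearMap.BilinForm.orthogonal_orthogonal hN hR] at this
    exact hwD this
  obtain ⟨u, huo, huw⟩ := hu
  have hwu : B w u ≠ 0 := fun h => huw (hR _ _ h)
  have hDw : ∀ t ∈ D, B t w = 0 := hwo
  have hDu : ∀ t ∈ D, B t u = 0 := huo
  have hDD : ∀ t ∈ D, ∀ s ∈ D, B s t = 0 := fun t ht => hD ht
  set D1 := D ⊔ Submodule.span K {w} with hD1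
  have hmem : ∀ t ∈ D1, ∃ s ∈ D, ∃ a : K, t = s + a • w := by
    intro t ht
    obtain ⟨u, hu, z, hz, rfl⟩ := Submodule.mem_sup.1 ht
    obtain ⟨a, rfl⟩ := Submodule.mem_span_singleton.1 hz
    exact ⟨u, hu, a, rfl⟩
  have hDle : D ≤ D1 := le_sup_left
  have hwin : w ∈ D1 := Submodule.mem_sup_right (Submodule.mem_span_singleton_self w)
  have hiso : D1 ≤ B.orthogonal D1 := by
    intro t ht s hs
    obtain ⟨t, ht', a, rfl⟩ := hmem t ht
    obtain ⟨s, hs', b, rfl⟩ := hmem s hs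
    have := hR _ _ (hDw t ht')
    simp [hDD t ht' s hs', hDw s hs', this, hA.self_eq_zero]
  set z := u + e with hz
  have hvz : B v z ≠ 0 := by simpa [hz, hDu v hv] using hev
  have hzv : B z v ≠ 0 := fun h => hvz (hR _ _ h)
  set S := D1 ⊓ B.orthogonal (Submodule.span K {z}) with hS
  have hSmem : ∀ t, t ∈ S ↔ t ∈ D1 ∧ B z t = 0 := by
    intro t
    rw [hS, Submodule.mem_inf, LinearMap.BilinForm.mem_orthogonal_iff]
    refine and_congr_right fun _ => ⟨fun h => h z (Submodule.mem_span_singleton_self z), ?_⟩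
    intro h s hs
    obtain ⟨c, rfl⟩ := Submodule.mem_span_singleton.1 hs
    simp [h]
  have hSle : S ≤ D1 := inf_le_left
  have hvS : v ∉ S := fun h => hzv ((hSmem v).1 h).2
  have hdec : ∀ t ∈ D1, t - (B z t / B z v) • v ∈ S := by
    intro t ht
    rw [hSmem]
    refine ⟨D1.sub_mem ht (D1.smul_mem _ (hDle hv)), ?_⟩
    simp [hzv]
  have hsup : S ⊔ Submodule.span K {v} = D1 := by
    apply le_antisymm
    · refine sup_le hSle ?_
      rw [Submodule.span_singleton_le_iff_mem]; exact hDle hv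
    · intro t ht
      rw [← sub_add_cancel t ((B z t / B z v) • v)]
      exact Submodule.add_mem_sup (hdec t ht)
        (Submodule.smul_mem _ _ (Submodule.mem_span_singleton_self v))
  have hoo : B.orthogonal D1 ≤ B.orthogonal S := LinearMap.BilinForm.orthogonal_le hSle
  refine ⟨S, hSle.trans (hiso.trans hoo), ?_, hoo (hiso (hDle hv)), hvS, ?_⟩
  · have h1 := aux_finrank_sup_singleton S v hvS
    have h2 := aux_finrank_sup_singleton D w hwD
    rw [hsup] at h1
    rw [← hD1] at h2
    omega
  · intro x hx hx0
    set c := B v x / B v z with hc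
    have hy : x - c • z ∈ B.orthogonal D1 := by
      intro t ht
      have h1 : B (t - (B z t / B z v) • v) x = 0 := hx _ (hdec t ht)
      have h2 : B (t - (B z t / B z v) • v) z = 0 := hR _ _ ((hSmem _).1 (hdec t ht)).2
      have h3 : B v (x - c • z) = 0 := by simp [hc, hvz]
      have h4 : B (t - (B z t / B z v) • v) (x - c • z) = 0 := by
        rw [map_sub, map_smul, h1, h2]; simp
      rw [LinearMap.BilinForm.sub_left, LinearMap.BilinForm.smul_left, h3] at h4
      simpa using h4
    have hyD : x - c • z ∈ B.orthogonal D := LinearMap.BilinForm.orthogonal_le hDle hy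
    by_cases hc0 : c = 0
    · rw [hc0] at hyD
      exact hd1 x (by simpa using hyD) hx0
    · have h5 : x - c • e = (x - c • z) + c • u := by rw [hz, smul_add]; abel
      have h6 : x - c • e ∈ B.orthogonal D := by
        rw [h5]; exact Submodule.add_mem _ hyD (Submodule.smul_mem _ _ huo)
      have h7 : x - c • e ∉ D := by
        intro h
        have h8 := hR _ _ (hDw _ h)
        have h9 : B w (x - c • z) = 0 := hy w hwin
        rw [h5, map_add, h9, map_smul, zero_add, smul_eq_mul] at h8
        exact (mul_ne_zero hc0 hwu) h8
      have := hd2 _ h6 h7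
      have := hsub x (c • e)
      have := he c
      omega

end AbstractForms

section MiddleLayer

open LinearMap (BilinForm)
open Module

theorem aux_le_minSwt {F : Type} [Field F] {n : ℕ} (S : Set ((Fin n → F) × (Fin n → F)))
    (d : ℕ) (x : (Fin n → F) × (Fin n → F)) (hx : x ∈ S) (hx0 : x ≠ 0)
    (h : ∀ v ∈ S, v ≠ 0 → d ≤ swt v) : d ≤ minSwt S := by
  apply le_csInf
  · exact ⟨swt x, x, ⟨hx, hx0⟩, rfl⟩
  · rintro _ ⟨v, ⟨hv, hv0⟩, rfl⟩
    exact h v hv hv0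

theorem aux_minSwt_le {F : Type} [Field F] {n : ℕ} (S : Set ((Fin n → F) × (Fin n → F)))
    (x : (Fin n → F) × (Fin n → F)) (hx : x ∈ S) (hx0 : x ≠ 0) : minSwt S ≤ swt x :=
  Nat.sInf_le ⟨x, ⟨hx, hx0⟩, rfl⟩

theorem aux_minSwt_mem {F : Type} [Field F] {n : ℕ} (S : Set ((Fin n → F) × (Fin n → F)))
    (x : (Fin n → F) × (Fin n → F)) (hx : x ∈ S) (hx0 : x ≠ 0) :
    ∃ v ∈ S, v ≠ 0 ∧ swt v = minSwt S := by
  have : minSwt S ∈ swt '' (S \ {0}) := Nat.sInf_mem ⟨swt x, x, ⟨hx, hx0⟩, rfl⟩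
  obtain ⟨v, ⟨hv, hv0⟩, h⟩ := this
  exact ⟨v, hv, hv0, h⟩

theorem aux_swt_sub {F : Type} [Field F] {n : ℕ} (a b : (Fin n → F) × (Fin n → F)) :
    swt (a - b) ≤ swt a + swt b := by
  unfold swt
  refine le_trans (Set.ncard_le_ncard ?_ (Set.toFinite _)) (Set.ncard_union_le _ _)
  intro i hi
  by_contra hcon
  simp only [Set.mem_union, Set.mem_ofPred_eq, not_or, not_not] at hcon
  apply hi
  simp [hcon.1.1, hcon.1.2, hcon.2.1, hcon.2.2]

theorem aux_fwd (p : ℕ) {F : Type} [Field F] [Fintype F] [CharP F p] {n : ℕ}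
    {K : Type} [Field K] [Finite K] [Module K ((Fin n → F) × (Fin n → F))]
    (B : BilinForm K ((Fin n → F) × (Fin n → F))) (hA : B.IsAlt) (hN : B.Nondegenerate)
    (hdual : ∀ W : Submodule K ((Fin n → F) × (Fin n → F)),
      sympDual p (W : Set ((Fin n → F) × (Fin n → F))) = (B.orthogonal W : Set _))
    (t : ℕ) (ht : 0 < t) (hq : Fintype.card F = Nat.card K ^ t)
    (k d d' r' : ℕ) (hr : r' < k)
    (C : Submodule K ((Fin n → F) × (Fin n → F)))
    (hC : IsSubsysCode p C.toAddSubgroup (Fintype.card F ^ k) 1 d)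
    (hP : PureTo C.toAddSubgroup d') :
    ∃ dr : ℕ, d ≤ dr ∧ ∃ C' : Submodule K ((Fin n → F) × (Fin n → F)),
      IsSubsysCode p C'.toAddSubgroup (Fintype.card F ^ (k - r')) (Fintype.card F ^ r') dr ∧
      PureTo C'.toAddSubgroup (min d d') := by
  have : FiniteDimensional K ((Fin n → F) × (Fin n → F)) := inferInstance
  have hκ : 1 < Nat.card K := Finite.one_lt_card
  have hcard : ∀ W : Submodule K ((Fin n → F) × (Fin n → F)),
      Nat.card W = Nat.card K ^ finrank K W := fun W => Module.natCard_eq_pow_finrank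
  have hV : finrank K ((Fin n → F) × (Fin n → F)) = 2 * (t * n) := by
    apply Nat.pow_right_injective hκ
    show Nat.card K ^ _ = Nat.card K ^ _
    rw [← Module.natCard_eq_pow_finrank, Nat.card_prod, Nat.card_fun, Nat.card_fin,
      Nat.card_eq_fintype_card (α := F), hq]
    ring
  obtain ⟨h1, h2, -, h4⟩ := hC
  simp only [Submodule.coe_toAddSubgroup] at h1 h2 h4
  rw [hdual C, ← Submodule.coe_inf] at h1 h4
  rw [hdual] at h4
  have h1' : Nat.card (C ⊓ B.orthogonal C : Submodule K _) * (Fintype.card F ^ k * 1)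
    = Fintype.card F ^ n := h1
  have h2' : Nat.card C * Fintype.card F ^ k = Fintype.card F ^ n * 1 := h2
  rw [hcard, hq, ← pow_mul, ← pow_mul, mul_one, ← pow_add] at h1'
  rw [hcard, hq, ← pow_mul, ← pow_mul, mul_one, ← pow_add] at h2'
  have e1 := Nat.pow_right_injective hκ h1'
  have e2 := Nat.pow_right_injective hκ h2'
  have hinf : C ⊓ B.orthogonal C = C :=
    Submodule.eq_of_le_of_finrank_eq inf_le_left (by omega)
  have hCC : C ≤ B.orthogonal C := inf_eq_left.1 hinf
  rw [hinf] at h4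
  have f1 := LinearMap.BilinForm.finrank_orthogonal hN C
  have f2 := Submodule.finrank_le C
  have htk : t * r' < t * k := Nat.mul_lt_mul_of_pos_left hr ht
  have htk' : t * (k - r') = t * k - t * r' := Nat.mul_sub _ _ _
  have hne : (B.orthogonal C : Set ((Fin n → F) × (Fin n → F))) ≠ C := by
    intro h
    have h' := SetLike.coe_injective h
    rw [h'] at f1
    omega
  have hd := h4 hne
  obtain ⟨W, hCW, hWC, hrad, hfr⟩ := aux_extend B hA hN C hCC (t * r') (by omega)
  have hneW : (B.orthogonal C : Set ((Fin n → F) × (Fin n → F))) ≠ W := by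
    intro h
    have h' := SetLike.coe_injective h
    rw [h'] at f1
    omega
  have hdle : ∀ v ∈ B.orthogonal C, v ∉ C → d ≤ swt v := by
    intro v hv hvC
    rw [hd]
    exact aux_minSwt_le _ v ⟨hv, hvC⟩ (fun h => hvC (h ▸ C.zero_mem))
  have hnle : ¬ B.orthogonal C ≤ W := fun h => hneW
    (congrArg _ (le_antisymm h hWC))
  obtain ⟨x, hx, hxW⟩ := SetLike.not_le_iff_exists.1 hnle
  refine ⟨minSwt ((B.orthogonal C : Set ((Fin n → F) × (Fin n → F))) \ W), ?_, W, ?_, ?_⟩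
  · refine aux_le_minSwt _ d x ⟨hx, hxW⟩ (fun h => hxW (h ▸ W.zero_mem)) ?_
    intro v hv _
    exact hdle v hv.1 (fun h => hv.2 (hCW h))
  · unfold IsSubsysCode
    simp only [Submodule.coe_toAddSubgroup]
    rw [hdual W, ← Submodule.coe_inf, hrad, hdual]
    refine ⟨?_, ?_, fun h => absurd h hneW, fun _ => rfl⟩
    · change Nat.card C * _ = _
      rw [hcard, hq, ← pow_mul, ← pow_mul, ← pow_mul, ← pow_add, ← pow_add]
      congr 1
      omega
    · change Nat.card W * _ = _
      rw [hcard, hq, ← pow_mul, ← pow_mul, ← pow_mul, ← pow_add, ← pow_add]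
      congr 1
      omega
  · intro v hv hv0
    by_cases hvC : v ∈ C
    · exact (min_le_right _ _).trans (hP v hvC hv0)
    · exact (min_le_left _ _).trans (hdle v (hWC hv) hvC)

theorem aux_bwd (p : ℕ) {F : Type} [Field F] [Fintype F] [CharP F p] {n : ℕ}
    {K : Type} [Field K] [Finite K] [Module K ((Fin n → F) × (Fin n → F))]
    (B : BilinForm K ((Fin n → F) × (Fin n → F))) (hA : B.IsAlt) (hN : B.Nondegenerate)
    (hdual : ∀ W : Submodule K ((Fin n → F) × (Fin n → F)),
      sympDual p (W : Set ((Fin n → F) × (Fin n → F))) = (B.orthogonal W : Set _))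
    (hloc : ∀ v : (Fin n → F) × (Fin n → F), v ≠ 0 → ∃ e, B v e ≠ 0 ∧
      ∀ c : K, swt (c • e) ≤ 1)
    (k r d : ℕ)
    (C : Submodule K ((Fin n → F) × (Fin n → F)))
    (hC : IsSubsysCode p C.toAddSubgroup (Fintype.card F ^ k) (Fintype.card F ^ r) d)
    (hP : PureTo C.toAddSubgroup d) :
    ∃ C' : Submodule K ((Fin n → F) × (Fin n → F)),
      IsSubsysCode p C'.toAddSubgroup (Fintype.card F ^ (k + r)) 1 d ∧
      PureTo C'.toAddSubgroup d := by
  have : FiniteDimensional K ((Fin n → F) × (Fin n → F)) := inferInstance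
  have hcard : ∀ W : Submodule K ((Fin n → F) × (Fin n → F)),
      Nat.card W = Nat.card K ^ finrank K W := fun W => Module.natCard_eq_pow_finrank
  obtain ⟨h1, h2, h3, h4⟩ := hC
  simp only [Submodule.coe_toAddSubgroup] at h1 h2 h3 h4
  rw [hdual C, ← Submodule.coe_inf] at h1 h3 h4
  rw [hdual] at h3 h4
  set D := C ⊓ B.orthogonal C with hDdef
  have hDC : D ≤ C := inf_le_left
  have hDD : D ≤ B.orthogonal D := inf_le_right.trans (LinearMap.BilinForm.orthogonal_le hDC)
  have hCD : C ≤ B.orthogonal D := by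
    intro x hx y hy
    exact hA.isRefl _ _ (hy.2 x hx)
  have h1' : Nat.card D * (Fintype.card F ^ k * Fintype.card F ^ r)
    = Fintype.card F ^ n := h1
  -- a criterion for a self-orthogonal code to be a good stabilizer code
  have key : ∀ S : Submodule K ((Fin n → F) × (Fin n → F)), S ≤ B.orthogonal S →
      finrank K S = finrank K D →
      ((B.orthogonal S : Set ((Fin n → F) × (Fin n → F))) = S → d = minSwt
        (B.orthogonal S : Set ((Fin n → F) × (Fin n → F)))) →
      ((B.orthogonal S : Set ((Fin n → F) × (Fin n → F))) ≠ S → d = minSwt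
        ((B.orthogonal S : Set ((Fin n → F) × (Fin n → F))) \ S)) →
      (∀ v ∈ S, v ≠ 0 → d ≤ swt v) →
      ∃ C' : Submodule K ((Fin n → F) × (Fin n → F)),
      IsSubsysCode p C'.toAddSubgroup (Fintype.card F ^ (k + r)) 1 d ∧
      PureTo C'.toAddSubgroup d := by
    intro S hS hfr ha hb hp
    refine ⟨S, ?_, hp⟩
    unfold IsSubsysCode
    simp only [Submodule.coe_toAddSubgroup]
    rw [hdual S, ← Submodule.coe_inf, inf_eq_left.2 hS, hdual]
    have hc : Nat.card S * Fintype.card F ^ (k + r) = Fintype.card F ^ n := by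
      rw [pow_add, ← h1', hcard, hcard, hfr]
    refine ⟨?_, ?_, ha, hb⟩
    · change Nat.card S * _ = _
      rw [mul_one, hc]
    · change Nat.card S * _ = _
      rw [mul_one, hc]
  have exact_case : ∀ S : Submodule K ((Fin n → F) × (Fin n → F)), S ≤ B.orthogonal S →
      finrank K S = finrank K D →
      (∀ v ∈ B.orthogonal S, v ≠ 0 → d ≤ swt v) →
      (∃ x ∈ B.orthogonal S, x ∉ S ∧ swt x = d) →
      ∃ C' : Submodule K ((Fin n → F) × (Fin n → F)),
      IsSubsysCode p C'.toAddSubgroup (Fintype.card F ^ (k + r)) 1 d ∧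
      PureTo C'.toAddSubgroup d := by
    intro S hS hfr hall ⟨x, hx, hxS, hxd⟩
    have hx0 : x ≠ 0 := fun h => hxS (h ▸ S.zero_mem)
    refine key S hS hfr ?_ ?_ (fun v hv => hall v (hS hv))
    · intro h
      have h' := SetLike.coe_injective h
      exact absurd (h' ▸ hx) hxS
    · intro _
      apply le_antisymm
      · exact aux_le_minSwt _ d x ⟨hx, hxS⟩ hx0 (fun v hv => hall v hv.1)
      · rw [← hxd]
        exact aux_minSwt_le _ x ⟨hx, hxS⟩ hx0
  by_cases hcase : (B.orthogonal D : Set ((Fin n → F) × (Fin n → F))) = C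
  · have hd := h3 hcase
    by_cases hself : B.orthogonal D ≤ D
    · have heq : B.orthogonal D = D := le_antisymm hself hDD
      exact key D hDD rfl (fun _ => hd) (fun h => absurd (congrArg _ heq) h)
        (fun v hv => hP v (hDC hv))
    · obtain ⟨x, hx, hxD⟩ := SetLike.not_le_iff_exists.1 hself
      have hall : ∀ v ∈ B.orthogonal D, v ≠ 0 → d ≤ swt v := by
        intro v hv hv0
        rw [hd]
        exact aux_minSwt_le _ v hv hv0
      by_cases hex : ∃ x ∈ B.orthogonal D, x ∉ D ∧ swt x = d
      · exact exact_case D hDD rfl hall hex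
      · obtain ⟨v, hv, hv0, hvd⟩ := aux_minSwt_mem _ x hx (fun h => hxD (h ▸ D.zero_mem))
        rw [← hd] at hvd
        have hvD : v ∈ D := by
          by_contra hvD
          exact hex ⟨v, hv, hvD, hvd⟩
        obtain ⟨e, hve, he⟩ := hloc v hv0
        obtain ⟨S, hS, hfr, hvo, hvS, hSall⟩ := aux_replace B hA hN swt aux_swt_sub D hDD d hall
          (by
            intro y hy hyD
            have h5 := hall y hy (fun h => hyD (h ▸ D.zero_mem))
            have h6 : swt y ≠ d := fun h => hex ⟨y, hy, hyD, h⟩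
            omega) hself v hvD e hve he
        exact exact_case S hS hfr hSall ⟨v, hvo, hvS, hvd⟩
  · have hd := h4 hcase
    have hnle : ¬ B.orthogonal D ≤ C := fun h => hcase (congrArg _ (le_antisymm h hCD))
    obtain ⟨x, hx, hxC⟩ := SetLike.not_le_iff_exists.1 hnle
    obtain ⟨v, hv, hv0, hvd⟩ := aux_minSwt_mem
      ((B.orthogonal D : Set ((Fin n → F) × (Fin n → F))) \ C) x ⟨hx, hxC⟩
      (fun h => hxC (h ▸ C.zero_mem))
    rw [← hd] at hvd
    refine exact_case D hDD rfl ?_ ⟨v, hv.1, fun h => hv.2 (hDC h), hvd⟩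
    intro y hy hy0
    by_cases hyC : y ∈ C
    · exact hP y hyC hy0
    · rw [hd]
      exact aux_minSwt_le _ y ⟨hy, hyC⟩ hy0

end MiddleLayer

section ConcreteForms

open LinearMap (BilinForm)
open Module

/-- The `F`-bilinear symplectic expression. -/
def auxSymp {F : Type} [Field F] {n : ℕ} (u v : (Fin n → F) × (Fin n → F)) : F :=
  ∑ i, (u.1 i * v.2 i - v.1 i * u.2 i)

theorem auxSymp_add_left {F : Type} [Field F] {n : ℕ} (u u' v : (Fin n → F) × (Fin n → F)) :
    auxSymp (u + u') v = auxSymp u v + auxSymp u' v := by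
  simp only [auxSymp, ← Finset.sum_add_distrib]
  refine Finset.sum_congr rfl fun i _ => ?_
  simp only [Prod.fst_add, Prod.snd_add, Pi.add_apply]
  ring

theorem auxSymp_add_right {F : Type} [Field F] {n : ℕ} (u v v' : (Fin n → F) × (Fin n → F)) :
    auxSymp u (v + v') = auxSymp u v + auxSymp u v' := by
  simp only [auxSymp, ← Finset.sum_add_distrib]
  refine Finset.sum_congr rfl fun i _ => ?_
  simp only [Prod.fst_add, Prod.snd_add, Pi.add_apply]
  ring

theorem auxSymp_smul_left {K F : Type} [Field K] [Field F] [Algebra K F] {n : ℕ} (c : K)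
    (u v : (Fin n → F) × (Fin n → F)) : auxSymp (c • u) v = c • auxSymp u v := by
  simp only [auxSymp, Finset.smul_sum]
  refine Finset.sum_congr rfl fun i _ => ?_
  simp only [Prod.smul_fst, Prod.smul_snd, Pi.smul_apply, smul_sub, smul_mul_assoc,
    mul_smul_comm]

theorem auxSymp_smul_right {K F : Type} [Field K] [Field F] [Algebra K F] {n : ℕ} (c : K)
    (u v : (Fin n → F) × (Fin n → F)) : auxSymp u (c • v) = c • auxSymp u v := by
  simp only [auxSymp, Finset.smul_sum]
  refine Finset.sum_congr rfl fun i _ => ?_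
  simp only [Prod.smul_fst, Prod.smul_snd, Pi.smul_apply, smul_sub, smul_mul_assoc,
    mul_smul_comm]

theorem auxSymp_self {F : Type} [Field F] {n : ℕ} (u : (Fin n → F) × (Fin n → F)) :
    auxSymp u u = 0 := by
  simp [auxSymp]

theorem auxSymp_local {F : Type} [Field F] {n : ℕ} (v : (Fin n → F) × (Fin n → F))
    (hv : v ≠ 0) : ∃ e, auxSymp v e ≠ 0 ∧ ∃ i, ∀ j, j ≠ i → e.1 j = 0 ∧ e.2 j = 0 := by
  by_cases h1 : v.1 = 0
  · have h2 : v.2 ≠ 0 := fun h2 => hv (Prod.ext h1 h2)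
    obtain ⟨i, hi⟩ := Function.ne_iff.1 h2
    refine ⟨(Pi.single i 1, 0), ?_, i, fun j hj => by simp [hj]⟩
    simpa [auxSymp, Pi.single_apply] using hi
  · obtain ⟨i, hi⟩ := Function.ne_iff.1 h1
    refine ⟨(0, Pi.single i 1), ?_, i, fun j hj => by simp [hj]⟩
    simpa [auxSymp, Pi.single_apply] using hi

theorem aux_swt_le_one {F : Type} [Field F] {n : ℕ} (e : (Fin n → F) × (Fin n → F))
    (i : Fin n) (h : ∀ j, j ≠ i → e.1 j = 0 ∧ e.2 j = 0) : swt e ≤ 1 := by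
  unfold swt
  rw [← Set.ncard_singleton i]
  refine Set.ncard_le_ncard ?_ (Set.toFinite _)
  intro j hj
  by_contra hcon
  exact hj (h j hcon)

/-- The symplectic form, scalar-valued through a `K`-linear functional. -/
noncomputable def auxForm {K F : Type} [Field K] [Field F] [Algebra K F] (n : ℕ)
    (f : F →ₗ[K] K) : BilinForm K ((Fin n → F) × (Fin n → F)) :=
  LinearMap.mk₂ K (fun u v => f (auxSymp u v))
    (fun u u' v => by rw [auxSymp_add_left, map_add])
    (fun c u v => by rw [auxSymp_smul_left, map_smul])
    (fun u v v' => by rw [auxSymp_add_right, map_add])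
    (fun c u v => by rw [auxSymp_smul_right, map_smul])

theorem auxForm_apply {K F : Type} [Field K] [Field F] [Algebra K F] (n : ℕ)
    (f : F →ₗ[K] K) (u v : (Fin n → F) × (Fin n → F)) :
    auxForm n f u v = f (auxSymp u v) := rfl

theorem auxForm_alt {K F : Type} [Field K] [Field F] [Algebra K F] (n : ℕ)
    (f : F →ₗ[K] K) : (auxForm n f).IsAlt := by
  intro u
  rw [auxForm_apply, auxSymp_self, map_zero]

theorem auxForm_local {K F : Type} [Field K] [Field F] [Algebra K F] (n : ℕ)
    (f : F →ₗ[K] K) (hf : ∀ x : F, x ≠ 0 → ∃ a : F, f (a * x) ≠ 0)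
    (v : (Fin n → F) × (Fin n → F)) (hv : v ≠ 0) :
    ∃ e, auxForm n f v e ≠ 0 ∧ ∀ c : K, swt (c • e) ≤ 1 := by
  obtain ⟨e, he, i, hi⟩ := auxSymp_local v hv
  obtain ⟨a, ha⟩ := hf _ he
  refine ⟨a • e, ?_, fun c => aux_swt_le_one _ i ?_⟩
  · rw [auxForm_apply, auxSymp_smul_right, smul_eq_mul]
    exact ha
  · intro j hj
    simp [hi j hj]

theorem auxForm_nondeg {K F : Type} [Field K] [Field F] [Algebra K F] (n : ℕ)
    (f : F →ₗ[K] K) (hf : ∀ x : F, x ≠ 0 → ∃ a : F, f (a * x) ≠ 0) :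
    (auxForm n f).Nondegenerate := by
  have hR : (auxForm n f).IsRefl := (auxForm_alt n f).isRefl
  rw [LinearMap.BilinForm.Nondegenerate, LinearMap.IsRefl.nondegenerate_iff_separatingLeft hR]
  intro x hx
  by_contra hx0
  obtain ⟨e, he, -⟩ := auxForm_local n f hf x hx0
  exact he (hx e)

theorem aux_trace (p : ℕ) [Fact p.Prime] {F : Type} [Field F] [Fintype F] [CharP F p]
    [Algebra (ZMod p) F] (x : F) (hx : x ≠ 0) :
    ∃ a : F, Algebra.trace (ZMod p) F (a * x) ≠ 0 := by
  obtain ⟨a, ha⟩ := Algebra.trace_surjective (ZMod p) F 1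
  refine ⟨a * x⁻¹, ?_⟩
  rw [inv_mul_cancel_right₀ hx, ha]
  exact one_ne_zero

theorem aux_form_p (p : ℕ) [Fact p.Prime] (F : Type) [Field F] [Fintype F] [CharP F p] (n : ℕ) :
    ∃ (_ : Module (ZMod p) ((Fin n → F) × (Fin n → F)))
      (B : BilinForm (ZMod p) ((Fin n → F) × (Fin n → F))), B.IsAlt ∧ B.Nondegenerate ∧
      (∀ W : Submodule (ZMod p) ((Fin n → F) × (Fin n → F)),
        sympDual p (W : Set ((Fin n → F) × (Fin n → F))) = (B.orthogonal W : Set _)) ∧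
      (∀ v : (Fin n → F) × (Fin n → F), v ≠ 0 → ∃ e, B v e ≠ 0 ∧
        ∀ c : ZMod p, swt (c • e) ≤ 1) ∧
      ∃ t : ℕ, 0 < t ∧ Fintype.card F = Nat.card (ZMod p) ^ t := by
  letI := ZMod.algebra F p
  have hf := aux_trace p (F := F)
  refine ⟨inferInstance, auxForm n (Algebra.trace (ZMod p) F), auxForm_alt _ _,
    auxForm_nondeg _ _ hf, fun W => rfl, auxForm_local _ _ hf,
    finrank (ZMod p) F, finrank_pos, ?_⟩
  rw [← Nat.card_eq_fintype_card, Module.natCard_eq_pow_finrank (K := ZMod p)]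

theorem aux_form_F (p : ℕ) [Fact p.Prime] (F : Type) [Field F] [Fintype F] [CharP F p] (n : ℕ) :
    ∃ (B : BilinForm F ((Fin n → F) × (Fin n → F))), B.IsAlt ∧ B.Nondegenerate ∧
      (∀ W : Submodule F ((Fin n → F) × (Fin n → F)),
        sympDual p (W : Set ((Fin n → F) × (Fin n → F))) = (B.orthogonal W : Set _)) ∧
      (∀ v : (Fin n → F) × (Fin n → F), v ≠ 0 → ∃ e, B v e ≠ 0 ∧
        ∀ c : F, swt (c • e) ≤ 1) := by
  letI := ZMod.algebra F p
  have hf : ∀ x : F, x ≠ 0 → ∃ a : F, (LinearMap.id : F →ₗ[F] F) (a * x) ≠ 0 :=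
    fun x hx => ⟨1, by simpa using hx⟩
  refine ⟨auxForm n LinearMap.id, auxForm_alt _ _, auxForm_nondeg _ _ hf, ?_,
    auxForm_local _ _ hf⟩
  intro W
  ext v
  constructor
  · intro hv w hw
    by_contra hne
    obtain ⟨a, ha⟩ := aux_trace p (auxSymp w v) hne
    apply ha
    rw [← smul_eq_mul, ← auxSymp_smul_left]
    exact hv (a • w) (W.smul_mem a hw)
  · intro hv w hw
    have h : auxSymp w v = 0 := hv w hw
    change Algebra.trace (ZMod p) F (auxSymp w v) = 0
    rw [h, map_zero]

/-- An `F`-linear additive code as a submodule. -/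
def auxToSub {F : Type} [Field F] {n : ℕ} (C : AddSubgroup ((Fin n → F) × (Fin n → F)))
    (h : FqLinear C) : Submodule F ((Fin n → F) × (Fin n → F)) :=
  { C with smul_mem' := fun a v hv => h a v hv }

end ConcreteForms

/-- Subsystem codes from stabilizer codes and conversely.
If there exists an `[[n,k,d]]_q` stabilizer code pure to `d'` (resp. `F_q`-linear),
then for every `0 ≤ r < k` there exists an `[[n, k−r, r, d_r]]_q` Clifford
subsystem code with `d_r ≥ d` that is pure to `min{d,d'}` (resp. `F_q`-linear).
Conversely, a pure `[[n,k,r,d]]_q` Clifford subsystem code (resp. `F_q`-linear)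
yields a pure `[[n, k+r, d]]_q` stabilizer code (resp. `F_q`-linear). -/
theorem subsystem_codes_from_stabilizer_codes
    (p : ℕ) (hp : p.Prime) (F : Type) [Field F] [Fintype F] [CharP F p]
    (n k r d d' : ℕ) :
    ((∃ C : AddSubgroup ((Fin n → F) × (Fin n → F)),
        IsSubsysCode p C (Fintype.card F ^ k) 1 d ∧ PureTo C d') →
      ∀ r' : ℕ, r' < k →
        ∃ dr : ℕ, d ≤ dr ∧
          ∃ C : AddSubgroup ((Fin n → F) × (Fin n → F)),
            IsSubsysCode p C (Fintype.card F ^ (k - r')) (Fintype.card F ^ r') dr ∧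
            PureTo C (min d d')) ∧
    ((∃ C : AddSubgroup ((Fin n → F) × (Fin n → F)),
        IsSubsysCode p C (Fintype.card F ^ k) 1 d ∧ FqLinear C ∧ PureTo C d') →
      ∀ r' : ℕ, r' < k →
        ∃ dr : ℕ, d ≤ dr ∧
          ∃ C : AddSubgroup ((Fin n → F) × (Fin n → F)),
            IsSubsysCode p C (Fintype.card F ^ (k - r')) (Fintype.card F ^ r') dr ∧
            FqLinear C ∧ PureTo C (min d d')) ∧
    ((∃ C : AddSubgroup ((Fin n → F) × (Fin n → F)),
        IsSubsysCode p C (Fintype.card F ^ k) (Fintype.card F ^ r) d ∧ PureTo C d) →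
      ∃ C : AddSubgroup ((Fin n → F) × (Fin n → F)),
        IsSubsysCode p C (Fintype.card F ^ (k + r)) 1 d ∧ PureTo C d) ∧
    ((∃ C : AddSubgroup ((Fin n → F) × (Fin n → F)),
        IsSubsysCode p C (Fintype.card F ^ k) (Fintype.card F ^ r) d ∧
        FqLinear C ∧ PureTo C d) →
      ∃ C : AddSubgroup ((Fin n → F) × (Fin n → F)),
        IsSubsysCode p C (Fintype.card F ^ (k + r)) 1 d ∧ FqLinear C ∧ PureTo C d) := by
  haveI : Fact p.Prime := ⟨hp⟩
  refine ⟨?_, ?_, ?_, ?_⟩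
  · rintro ⟨C, hC, hP⟩ r' hr
    obtain ⟨_, B, hA, hN, hdual, -, t, ht, hq⟩ := aux_form_p p F n
    obtain ⟨dr, hdr, C', h1, h2⟩ := aux_fwd p B hA hN hdual t ht hq k d d' r' hr
      (AddSubgroup.toZModSubmodule p C) hC hP
    exact ⟨dr, hdr, C'.toAddSubgroup, h1, h2⟩
  · rintro ⟨C, hC, hL, hP⟩ r' hr
    obtain ⟨B, hA, hN, hdual, -⟩ := aux_form_F p F n
    obtain ⟨dr, hdr, C', h1, h2⟩ := aux_fwd p B hA hN hdual 1 one_pos (by simp) k d d' r' hr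
      (auxToSub C hL) hC hP
    exact ⟨dr, hdr, C'.toAddSubgroup, h1, fun a v hv => C'.smul_mem a hv, h2⟩
  · rintro ⟨C, hC, hP⟩
    obtain ⟨_, B, hA, hN, hdual, hloc, -⟩ := aux_form_p p F n
    obtain ⟨C', h1, h2⟩ := aux_bwd p B hA hN hdual hloc k r d
      (AddSubgroup.toZModSubmodule p C) hC hP
    exact ⟨C'.toAddSubgroup, h1, h2⟩
  · rintro ⟨C, hC, hL, hP⟩
    obtain ⟨B, hA, hN, hdual, hloc⟩ := aux_form_F p F n
    obtain ⟨C', h1, h2⟩ := aux_bwd p B hA hN hdual hloc k r d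
      (auxToSub C hL) hC hP
    exact ⟨C'.toAddSubgroup, h1, fun a v hv => C'.smul_mem a hv, h2⟩
end

section
/- Existence of BCH subsystem codes for all co-subsystem dimensions (Euclidean): Let q be a prime power, m ≥ 2 an integer, n = q^m − 1, and let δ be an integer with 2 ≤ δ ≤ q^{⌈m/2⌉} − 1 − (q−2)·[m odd]. Then for every integer r with 0 ≤ r < n − 2m⌈(δ−1)(1−1/q)⌉ there exists a Clifford subsystem code with parameters [[q^m − 1, n − 2m⌈(δ−1)(1−1/q)⌉ − r, r, d]]_q with minimum distance d ≥ δ. -/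
open Finset

section LinAlg
open Module

/-- The dot product as a bilinear form. -/
noncomputable def bchForm (F : Type) [Field F] (n : ℕ) : LinearMap.BilinForm F (Fin n → F) :=
  dotProductBilin F F

lemma bchForm_apply {F : Type} [Field F] {n : ℕ} (x y : Fin n → F) :
    bchForm F n x y = ∑ i, x i * y i := rfl

lemma bchForm_comm {F : Type} [Field F] {n : ℕ} (x y : Fin n → F) :
    bchForm F n x y = bchForm F n y x := by
  simp only [bchForm_apply, mul_comm]

lemma bchForm_refl {F : Type} [Field F] {n : ℕ} : (bchForm F n).IsRefl := by
  intro x y h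
  rw [bchForm_comm]; exact h

lemma bchForm_nondeg {F : Type} [Field F] {n : ℕ} : (bchForm F n).Nondegenerate := by
  constructor
  · intro x h
    exact dotProduct_eq_zero x h
  · intro x h
    refine dotProduct_eq_zero x fun w => ?_
    have := h w
    rw [bchForm_comm] at this
    exact this

lemma mem_orth {F : Type} [Field F] {n : ℕ} (A : Submodule F (Fin n → F)) (x : Fin n → F) :
    x ∈ (bchForm F n).orthogonal A ↔ ∀ y ∈ A, bchForm F n x y = 0 := by
  rw [LinearMap.BilinForm.mem_orthogonal_iff]
  refine forall₂_congr fun y _ => ?_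
  rw [bchForm_comm x y]

lemma exists_between_finrank {F V : Type} [Field F] [AddCommGroup V] [Module F V]
    [FiniteDimensional F V] (A B : Submodule F V) (hAB : A ≤ B) (t : ℕ)
    (h1 : finrank F A ≤ t) (h2 : t ≤ finrank F B) :
    ∃ E : Submodule F V, A ≤ E ∧ E ≤ B ∧ finrank F E = t := by
  induction t, h1 using Nat.le_induction with
  | base => exact ⟨A, le_rfl, hAB, rfl⟩
  | succ t ht ih =>
    obtain ⟨E, hA, hB, hE⟩ := ih (by omega)
    have hne : ¬ B ≤ E := fun h => by
      have := Submodule.finrank_mono h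
      omega
    obtain ⟨v, hv, hvE⟩ := SetLike.not_le_iff_exists.mp hne
    refine ⟨E ⊔ F ∙ v, hA.trans le_sup_left, sup_le hB (by simpa using hv), ?_⟩
    have hd : E ⊓ F ∙ v = ⊥ := by
      rw [← disjoint_iff]
      refine (Submodule.disjoint_span_singleton' ?_).2 hvE
      rintro rfl; exact hvE E.zero_mem
    have := Submodule.finrank_sup_add_finrank_inf_eq E (F ∙ v)
    rw [hd, finrank_bot, finrank_span_singleton (by rintro rfl; exact hvE E.zero_mem)] at this
    omega

lemma sympDual_prod (p : ℕ) (hp : p.Prime) {F : Type} [Field F] [Fintype F] [CharP F p] {n : ℕ}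
    (P Y : Submodule F (Fin n → F)) :
    sympDual p ((P.prod Y : Submodule F _) : Set ((Fin n → F) × (Fin n → F))) =
      (((bchForm F n).orthogonal Y).prod ((bchForm F n).orthogonal P) : Submodule F _) := by
  let := ZMod.algebra F p
  have : Fact p.Prime := ⟨hp⟩
  have key : ∀ u v : (Fin n → F) × (Fin n → F), trSympForm p u v =
      Algebra.trace (ZMod p) F (bchForm F n u.2 v.1 - bchForm F n u.1 v.2) := by
    intro u v
    simp only [trSympForm, bchForm_apply, Finset.sum_sub_distrib, mul_comm]
  have nd : ∀ a : F, (∀ b : F, Algebra.trace (ZMod p) F (b * a) = 0) → a = 0 := by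
    intro a h
    refine (traceForm_nondegenerate (ZMod p) F).1 a fun b => ?_
    rw [Algebra.traceForm_apply, mul_comm]; exact h b
  ext ⟨x, y⟩
  simp only [sympDual, Set.mem_ofPred_eq, SetLike.mem_coe, Submodule.mem_prod, mem_orth, key]
  constructor
  · intro h
    constructor
    · intro w hw
      refine nd _ fun b => ?_
      have := h (0, (-b) • w) ⟨P.zero_mem, Y.smul_mem _ hw⟩
      simpa using this
    · intro w hw
      refine nd _ fun b => ?_
      have := h (b • w, 0) ⟨P.smul_mem _ hw, Y.zero_mem⟩
      simpa using this
  · rintro ⟨h1, h2⟩ w ⟨hw1, hw2⟩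
    rw [h1 _ hw2, h2 _ hw1]; simp

lemma card_prod_sub {F : Type} [Field F] [Fintype F] {n : ℕ}
    (P Y : Submodule F (Fin n → F)) :
    Nat.card (P.prod Y : Submodule F _) = Fintype.card F ^ (finrank F P + finrank F Y) := by
  have e : (P.prod Y : Submodule F _) ≃ P × Y :=
    Equiv.Set.prod (P : Set (Fin n → F)) (Y : Set (Fin n → F))
  rw [Nat.card_congr e, Nat.card_prod, Module.natCard_eq_pow_finrank (K := F) (V := P),
    Module.natCard_eq_pow_finrank (K := F) (V := Y), pow_add, Nat.card_eq_fintype_card]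

lemma subsys_of_selforth (p : ℕ) (hp : p.Prime) {F : Type} [Field F] [Fintype F] [CharP F p]
    {n : ℕ} (A : Submodule F (Fin n → F)) (k δ r : ℕ)
    (hA : A ≤ (bchForm F n).orthogonal A) (hk : finrank F A ≤ k)
    (hd : ∀ x ∈ (bchForm F n).orthogonal A, x ≠ 0 → δ ≤ hwt x)
    (hr : r < n - 2 * k) :
    ∃ d : ℕ, δ ≤ d ∧
        ∃ Q : AddSubgroup ((Fin n → F) × (Fin n → F)),
          IsSubsysCode p Q (Fintype.card F ^ (n - 2 * k - r)) (Fintype.card F ^ r) d := by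
  set O := (bchForm F n).orthogonal with hO
  have fO : ∀ W, finrank F (O W) = n - finrank F W := fun W => by
    rw [hO, LinearMap.BilinForm.finrank_orthogonal bchForm_nondeg]; simp
  have OO : ∀ W, O (O W) = W := fun W =>
    LinearMap.BilinForm.orthogonal_orthogonal bchForm_nondeg bchForm_refl W
  have Omono : ∀ {U W}, U ≤ W → O W ≤ O U := fun h =>
    LinearMap.BilinForm.orthogonal_le h
  set k' := finrank F A with hk'
  obtain ⟨P, hAP, hPB, hP⟩ := exists_between_finrank A (O A) hA (2 * k - k' + r)
    (by omega) (by rw [fO]; omega)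
  obtain ⟨E, hAE, hEP, hE⟩ := exists_between_finrank A P hAP (2 * k - k')
    (by omega) (by omega)
  obtain ⟨X, hX1, hX2⟩ := IsModularLattice.exists_inf_eq_and_sup_eq hEP hPB
  have hX : finrank F X = n - (r + k') := by
    have := Submodule.finrank_sup_add_finrank_inf_eq P X
    rw [hX1, hX2, fO] at this
    omega
  have hAX : A ≤ X := hAE.trans (hX1 ▸ inf_le_right)
  have hXle : X ≤ O A := hX2 ▸ le_sup_right
  have hPX : O X ⊓ O P = A := by
    apply le_antisymm
    · rw [← OO A, ← hX2]
      intro x hx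
      rw [hO, mem_orth]
      intro y hy
      obtain ⟨a, ha, b, hb, rfl⟩ := Submodule.mem_sup.mp hy
      rw [map_add, (mem_orth _ _).1 hx.2 a ha, (mem_orth _ _).1 hx.1 b hb, add_zero]
    · refine le_inf ?_ ?_
      · rw [← OO A]; exact Omono hXle
      · rw [← OO A]; exact Omono hPB
  set C : Submodule F ((Fin n → F) × (Fin n → F)) := P.prod (O X) with hC
  have hDs : (C : Set ((Fin n → F) × (Fin n → F))) ∩ sympDual p (C : Set ((Fin n → F) × (Fin n → F))) =
      ((E.prod A : Submodule F _) : Set ((Fin n → F) × (Fin n → F))) := by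
    rw [hC, sympDual_prod p hp, ← hO, OO, ← Submodule.coe_inf, Submodule.prod_inf_prod, hX1, hPX]
  have hDd : sympDual p ((E.prod A : Submodule F _) : Set ((Fin n → F) × (Fin n → F))) =
      (((O A).prod (O E) : Submodule F _) : Set _) := sympDual_prod p hp E A
  have hEA : O E ≤ O A := Omono hAE
  have hwtle1 : ∀ v : (Fin n → F) × (Fin n → F), hwt v.1 ≤ swt v := fun v =>
    Set.ncard_le_ncard (fun i hi h => hi h.1) (Set.toFinite _)
  have hwtle2 : ∀ v : (Fin n → F) × (Fin n → F), hwt v.2 ≤ swt v := fun v =>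
    Set.ncard_le_ncard (fun i hi h => hi h.2) (Set.toFinite _)
  have hnot : ¬ O A ≤ P := fun h => by
    have := Submodule.finrank_mono h
    rw [fO] at this; omega
  obtain ⟨v, hv, hvP⟩ := SetLike.not_le_iff_exists.mp hnot
  have hvmem : ((v, 0) : (Fin n → F) × (Fin n → F)) ∈
      (((O A).prod (O E) : Submodule F _) : Set _) := ⟨hv, (O E).zero_mem⟩
  have hvC : ((v, 0) : (Fin n → F) × (Fin n → F)) ∉ (C : Set _) := fun h => hvP h.1
  refine ⟨minSwt ((((O A).prod (O E) : Submodule F _) : Set ((Fin n → F) × (Fin n → F))) \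
    (C : Set ((Fin n → F) × (Fin n → F)))), ?_,
    C.toAddSubgroup, ?_⟩
  · refine le_csInf ?_ ?_
    · refine ⟨_, _, ⟨⟨hvmem, hvC⟩, ?_⟩, rfl⟩
      intro h
      rw [Set.mem_singleton_iff] at h
      exact hvC (h ▸ C.zero_mem)
    · rintro _ ⟨w, ⟨⟨hw, -⟩, hw0⟩, rfl⟩
      by_cases h1 : w.1 = 0
      · have h2 : w.2 ≠ 0 := fun h2 => hw0 (Prod.ext h1 h2)
        exact (hd _ (hEA hw.2) h2).trans (hwtle2 w)
      · exact (hd _ hw.1 h1).trans (hwtle1 w)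
  · unfold IsSubsysCode
    simp only [Submodule.coe_toAddSubgroup]
    rw [hDs, hDd]
    refine ⟨?_, ?_, ?_, fun _ => rfl⟩
    · have := card_prod_sub E A
      rw [SetLike.coe_sort_coe, this, ← pow_add, ← pow_add]
      congr 1; omega
    · have := card_prod_sub P (O X)
      change Nat.card C * _ = _
      rw [hC, this, ← pow_add, ← pow_add, fO]
      congr 1; omega
    · intro h
      exact absurd (h ▸ hvmem) hvC

end LinAlg

section BCH
open Module

lemma bch_arith (q m δ j j' c : ℕ) (hq : 2 ≤ q) (hm : 2 ≤ m)
    (hδ2 : δ ≤ q ^ ((m + 1) / 2) - 1 - (q - 2) * (if Odd m then 1 else 0))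
    (hj : 1 ≤ j) (hjδ : j < δ) (hj' : 1 ≤ j') (hjδ' : j' < δ) (hc : c ≤ m / 2) :
    ¬ (q ^ m - 1) ∣ j * q ^ c + j' := by
  intro hdvd
  have hle := Nat.le_of_dvd (by positivity) hdvd
  have hcp : q ^ c ≤ q ^ (m / 2) := Nat.pow_le_pow_right (by omega) hc
  have hq0 : 1 ≤ q ^ (m / 2) := Nat.one_le_pow _ _ (by omega)
  rcases Nat.even_or_odd' m with ⟨t, rfl | rfl⟩
  · have h1 : (2 * t + 1) / 2 = t := by omega
    have h2 : 2 * t / 2 = t := by omega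
    have h3 : ¬ Odd (2 * t) := by simp
    rw [h2] at hcp hq0
    simp only [h1, h3, if_false, mul_zero, Nat.sub_zero] at hδ2
    have hjt : j + 2 ≤ q ^ t := by omega
    have hjt' : j' + 2 ≤ q ^ t := by omega
    have e : q ^ (2 * t) = q ^ t * q ^ t := by rw [two_mul, pow_add]
    rw [e] at hle
    have h4 : j * q ^ c ≤ j * q ^ t := Nat.mul_le_mul_left _ hcp
    have h5 : (j + 2) * q ^ t ≤ q ^ t * q ^ t := Nat.mul_le_mul_right _ hjt
    rw [add_mul] at h5
    omega
  · have h1 : (2 * t + 1 + 1) / 2 = t + 1 := by omega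
    have h2 : (2 * t + 1) / 2 = t := by omega
    have h3 : Odd (2 * t + 1) := ⟨t, rfl⟩
    rw [h2] at hcp hq0
    simp only [h1, h3, if_true, mul_one] at hδ2
    have hjt : j + q ≤ q ^ (t + 1) := by omega
    have hjt' : j' + q ≤ q ^ (t + 1) := by omega
    have e : q ^ (2 * t + 1) = q ^ (t + 1) * q ^ t := by rw [← pow_add]; congr 1; omega
    have e2 : q ^ (t + 1) = q * q ^ t := by rw [pow_succ, mul_comm]
    rw [e] at hle
    have h4 : j * q ^ c ≤ j * q ^ t := Nat.mul_le_mul_left _ hcp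
    have h5 : (j + q) * q ^ t ≤ q ^ (t + 1) * q ^ t := Nat.mul_le_mul_right _ hjt
    rw [add_mul, ← e2] at h5
    omega

lemma bch_arith' (q m δ j j' c : ℕ) (hq : 2 ≤ q) (hm : 2 ≤ m)
    (hδ2 : δ ≤ q ^ ((m + 1) / 2) - 1 - (q - 2) * (if Odd m then 1 else 0))
    (hj : 1 ≤ j) (hjδ : j < δ) (hj' : 1 ≤ j') (hjδ' : j' < δ) (hc : c < m) :
    ¬ (q ^ m - 1) ∣ j * q ^ c + j' := by
  by_cases h : c ≤ m / 2
  · exact bch_arith q m δ j j' c hq hm hδ2 hj hjδ hj' hjδ' h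
  · intro hd
    refine bch_arith q m δ j' j (m - c) hq hm hδ2 hj' hjδ' hj hjδ (by omega) ?_
    have h1 : (q ^ m - 1) ∣ (j * q ^ c + j') * q ^ (m - c) := hd.mul_right _
    have h2 : (j * q ^ c + j') * q ^ (m - c) = (j' * q ^ (m - c) + j) + j * (q ^ m - 1) := by
      have e : q ^ m = q ^ c * q ^ (m - c) := by rw [← pow_add]; congr 1; omega
      have e1 : 1 ≤ q ^ m := Nat.one_le_pow _ _ (by omega)
      have e2 : j * (q ^ m - 1) + j = j * q ^ m := by
        rw [← Nat.mul_succ]; congr 1; omega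
      rw [add_assoc, add_comm j, e2, e]; ring
    rw [h2] at h1
    exact (Nat.dvd_add_left (Dvd.intro_left j rfl)).1 h1

lemma bch_arith'' (q m δ j j' a b : ℕ) (hq : 2 ≤ q) (hm : 2 ≤ m)
    (hδ2 : δ ≤ q ^ ((m + 1) / 2) - 1 - (q - 2) * (if Odd m then 1 else 0))
    (hj : 1 ≤ j) (hjδ : j < δ) (hj' : 1 ≤ j') (hjδ' : j' < δ) (ha : a < m) (hb : b < m) :
    ¬ (q ^ m - 1) ∣ j * q ^ a + j' * q ^ b := by
  wlog hab : b ≤ a generalizing a b j j'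
  · rw [add_comm]
    exact this j' j b a hj' hjδ' hj hjδ hb ha (by omega)
  intro hd
  refine bch_arith' q m δ j j' (a - b) hq hm hδ2 hj hjδ hj' hjδ' (by omega) ?_
  have e : j * q ^ a + j' * q ^ b = (j * q ^ (a - b) + j') * q ^ b := by
    have : q ^ a = q ^ (a - b) * q ^ b := by rw [← pow_add]; congr 1; omega
    rw [this]; ring
  rw [e] at hd
  refine Nat.Coprime.dvd_of_dvd_mul_right ?_ hd
  refine Nat.Coprime.pow_right _ ?_
  have h1 : Nat.Coprime (q ^ m - 1) (q ^ m) := by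
    have : 1 ≤ q ^ m := Nat.one_le_pow _ _ (by omega)
    have h2 : q ^ m = (q ^ m - 1) + 1 := by omega
    rw [h2]; simp
  exact Nat.Coprime.coprime_dvd_right (dvd_pow_self q (by omega)) h1

/-- The Vandermonde (BCH) bound. -/
lemma bch_bound {F K : Type} [Field F] [Field K] [Algebra F K] {n : ℕ} (x : Fin n → K)
    (hinj : Function.Injective x) (h0 : ∀ i, x i ≠ 0) (δ : ℕ) (y : Fin n → F) (hy : y ≠ 0)
    (h : ∀ j, 1 ≤ j → j < δ → ∑ i, algebraMap F K (y i) * x i ^ j = 0) : δ ≤ hwt y := by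
  classical
  by_contra! hlt
  obtain ⟨i0, hi0⟩ := Function.ne_iff.mp hy
  set S : Finset (Fin n) := Finset.univ.filter (fun i => y i ≠ 0) with hS
  have hcard : S.card = hwt y := by
    unfold hwt
    rw [← Set.ncard_coe_finset]; congr 1; ext i; simp [hS]
  have hi0S : i0 ∈ S := by simpa [hS] using hi0
  set f : Polynomial K := Polynomial.X * ∏ i ∈ S.erase i0, (Polynomial.X - Polynomial.C (x i))
    with hf
  have hdeg : f.natDegree < δ := by
    rw [hf, Polynomial.natDegree_X_mul, Polynomial.natDegree_prod_of_monic]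
    · simp only [Polynomial.natDegree_X_sub_C, Finset.sum_const, smul_eq_mul, mul_one]
      rw [Finset.card_erase_of_mem hi0S]
      have : 0 < S.card := Finset.card_pos.2 ⟨_, hi0S⟩
      omega
    · intro i _; exact Polynomial.monic_X_sub_C _
    · exact Finset.prod_ne_zero_iff.2 fun i _ => Polynomial.X_sub_C_ne_zero _
  have hz : ∑ i, algebraMap F K (y i) * f.eval (x i) = 0 := by
    simp_rw [Polynomial.eval_eq_sum_range' hdeg, Finset.mul_sum]
    rw [Finset.sum_comm]
    refine Finset.sum_eq_zero fun j hj => ?_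
    rcases Nat.eq_zero_or_pos j with rfl | hj0
    · simp [hf]
    · have := h j hj0 (Finset.mem_range.1 hj)
      calc _ = f.coeff j * ∑ i, algebraMap F K (y i) * x i ^ j := by
            rw [Finset.mul_sum]; exact Finset.sum_congr rfl fun i _ => by ring
        _ = 0 := by rw [this, mul_zero]
  rw [Finset.sum_eq_single i0] at hz
  · rcases mul_eq_zero.1 hz with h1 | h1
    · exact hi0 ((map_eq_zero _).1 h1)
    · rw [hf, Polynomial.eval_mul, Polynomial.eval_X, Polynomial.eval_prod] at h1
      rcases mul_eq_zero.1 h1 with h2 | h2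
      · exact h0 _ h2
      · obtain ⟨i, hi, hi2⟩ := Finset.prod_eq_zero_iff.1 h2
        simp only [Polynomial.eval_sub, Polynomial.eval_X, Polynomial.eval_C] at hi2
        exact (Finset.mem_erase.1 hi).1 (hinj (sub_eq_zero.1 hi2)).symm
  · intro i _ hi
    by_cases hyi : y i = 0
    · simp [hyi]
    · have : f.eval (x i) = 0 := by
        rw [hf, Polynomial.eval_mul, Polynomial.eval_prod]
        rw [Finset.prod_eq_zero (i := i)]
        · simp
        · simp [hS, hi, hyi]
        · simp
      rw [this, mul_zero]
  · simp

lemma bch_exists (p : ℕ) (hp : p.Prime) (F : Type) [Field F] [Fintype F] [CharP F p]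
    (m n δ : ℕ) (hm : 2 ≤ m)
    (hn : n = Fintype.card F ^ m - 1)
    (hδ2 : δ ≤ Fintype.card F ^ ((m + 1) / 2) - 1 -
      (Fintype.card F - 2) * (if Odd m then 1 else 0)) :
    ∃ A : Submodule F (Fin n → F), A ≤ (bchForm F n).orthogonal A ∧
      finrank F A ≤ m * ((Finset.Ioo 0 δ).filter (fun j => ¬ Fintype.card F ∣ j)).card ∧
      ∀ x ∈ (bchForm F n).orthogonal A, x ≠ 0 → δ ≤ hwt x := by
  classical
  have : Fact p.Prime := ⟨hp⟩
  have : NeZero m := ⟨by omega⟩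
  let K := FiniteField.Extension F p m
  let : Fintype K := Fintype.ofFinite K
  set q := Fintype.card F with hq
  have hq2 : 2 ≤ q := Fintype.one_lt_card
  have hK : Fintype.card K = q ^ m := by
    rw [← Nat.card_eq_fintype_card, FiniteField.natCard_extension F p m, Nat.card_eq_fintype_card]
  have hKr : finrank F K = m := FiniteField.finrank_extension F p m
  have e : Fin n ≃ Kˣ := (Fintype.equivFinOfCardEq (by rw [Fintype.card_units, hK, hn])).symm
  let x : Fin n → K := fun i => (e i : K)
  have hx0 : ∀ i, x i ≠ 0 := fun i => (e i).ne_zero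
  have hxinj : Function.Injective x := fun i j h => e.injective (Units.ext h)
  set J := (Finset.Ioo 0 δ).filter (fun j => ¬ q ∣ j) with hJ
  let Φ : (J → K) →ₗ[F] (Fin n → F) := LinearMap.pi fun i =>
    ∑ j : J, (Algebra.trace F K) ∘ₗ (LinearMap.mulRight F (x i ^ (j : ℕ))) ∘ₗ LinearMap.proj j
  have hΦ : ∀ c i, Φ c i = ∑ j : J, Algebra.trace F K (c j * x i ^ (j : ℕ)) := by
    intro c i
    simp [Φ]
  have hsum : ∀ t : ℕ, ¬ (q ^ m - 1) ∣ t → ∑ i, x i ^ t = 0 := by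
    intro t ht
    have := FiniteField.sum_pow_units K t
    rw [hK, if_neg ht] at this
    rw [← this]
    exact Equiv.sum_comp e (fun u : Kˣ => (u : K) ^ t)
  have horth : ∀ (c c' : K) (j j' : J),
      ∑ i, Algebra.trace F K (c * x i ^ (j : ℕ)) * Algebra.trace F K (c' * x i ^ (j' : ℕ)) = 0 := by
    intro c c' j j'
    apply (algebraMap F K).injective
    simp only [map_sum, map_mul, FiniteField.algebraMap_trace_eq_sum_pow, map_zero,
      Finset.sum_mul_sum, hKr, Nat.card_eq_fintype_card, ← hq]
    rw [Finset.sum_comm]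
    refine Finset.sum_eq_zero fun a ha => ?_
    rw [Finset.sum_comm]
    refine Finset.sum_eq_zero fun b hb => ?_
    have hj := Finset.mem_Ioo.1 (Finset.mem_filter.1 j.2).1
    have hj' := Finset.mem_Ioo.1 (Finset.mem_filter.1 j'.2).1
    have := hsum _ (bch_arith'' q m δ j j' a b hq2 hm hδ2 hj.1 hj.2 hj'.1 hj'.2
      (Finset.mem_range.1 ha) (Finset.mem_range.1 hb))
    calc _ = c ^ q ^ a * c' ^ q ^ b * ∑ i, x i ^ ((j : ℕ) * q ^ a + j' * q ^ b) := by
          rw [Finset.mul_sum]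
          refine Finset.sum_congr rfl fun i _ => ?_
          rw [mul_pow, mul_pow, pow_add, pow_mul, pow_mul]; ring
      _ = 0 := by rw [this, mul_zero]
  refine ⟨LinearMap.range Φ, ?_, ?_, ?_⟩
  · rintro _ ⟨c, rfl⟩
    rw [mem_orth]
    rintro _ ⟨c', rfl⟩
    simp only [bchForm_apply, hΦ, Finset.sum_mul_sum]
    rw [Finset.sum_comm]
    refine Finset.sum_eq_zero fun j _ => ?_
    rw [Finset.sum_comm]
    exact Finset.sum_eq_zero fun j' _ => horth _ _ _ _
  · refine (LinearMap.finrank_range_le Φ).trans ?_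
    rw [Module.finrank_pi_fintype]
    simp [hKr, mul_comm]
  · intro y hy hy0
    rw [mem_orth] at hy
    refine bch_bound x hxinj hx0 δ y hy0 ?_
    have hJz : ∀ j : J, ∑ i, algebraMap F K (y i) * x i ^ (j : ℕ) = 0 := by
      intro j
      refine (traceForm_nondegenerate F K).1 _ fun c => ?_
      have h1 := hy _ ⟨Pi.single j c, rfl⟩
      rw [bchForm_apply] at h1
      rw [Algebra.traceForm_apply, Finset.sum_mul, map_sum, ← h1]
      refine Finset.sum_congr rfl fun i _ => ?_
      rw [hΦ, Finset.sum_eq_single j]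
      · rw [Pi.single_eq_same, ← smul_eq_mul (y i), ← map_smul, Algebra.smul_def]
        congr 1; ring
      · intro b _ hb; rw [Pi.single_eq_of_ne hb]; simp
      · simp
    intro j
    induction j using Nat.strong_induction_on with
    | _ j ih =>
      intro hj1 hjδ
      by_cases hd : q ∣ j
      · obtain ⟨t, rfl⟩ := hd
        have ht1 : 1 ≤ t := by
          rcases Nat.eq_zero_or_pos t with rfl | h
          · simp at hj1
          · exact h
        have htlt : t < q * t := by nlinarith
        have h1 := ih t htlt ht1 (by omega)
        have h2 : (FiniteField.frobeniusAlgHom F K) (∑ i, algebraMap F K (y i) * x i ^ t) = 0 := by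
          rw [h1, map_zero]
        rw [map_sum] at h2
        rw [← h2]
        refine Finset.sum_congr rfl fun i _ => ?_
        rw [map_mul, AlgHom.commutes, map_pow, FiniteField.coe_frobeniusAlgHom, ← pow_mul]
      · exact hJz ⟨j, by simp [hJ, hd, hjδ]; try omega⟩

lemma card_filter_bch (q δ : ℕ) (hq : 2 ≤ q) (hδ : 2 ≤ δ) :
    ((Finset.Ioo 0 δ).filter (fun j => ¬ q ∣ j)).card ≤
      ⌈((δ : ℚ) - 1) * (1 - 1 / (q : ℚ))⌉₊ := by
  have h1 := Finset.card_filter_add_card_filter_not (s := Finset.Ioo 0 δ) (fun j => q ∣ j)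
  have h2 : ((Finset.Ioo 0 δ).filter (fun j => q ∣ j)).card = (δ - 1) / q := by
    rw [← Nat.Ioc_filter_dvd_card_eq_div]
    congr 1
  rw [h2, Nat.card_Ioo] at h1
  have hq0 : (0 : ℚ) < q := by positivity
  have h4 : ((δ - 1 : ℕ) : ℚ) = δ - 1 := by push_cast [Nat.cast_sub (by omega : 1 ≤ δ)]; ring
  generalize ((Finset.Ioo 0 δ).filter (fun j => ¬ q ∣ j)).card = c at *
  rcases Nat.eq_zero_or_pos c with rfl | hc
  · exact Nat.zero_le _
  obtain ⟨c, rfl⟩ : ∃ b, c = b + 1 := ⟨c - 1, by omega⟩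
  rw [Nat.succ_le_iff, Nat.lt_ceil, ← h4]
  have h5 : δ - 1 < ((δ - 1) / q + 1) * q := by
    rw [mul_comm]; exact Nat.lt_mul_div_succ (δ - 1) (by omega)
  have h6 : ((δ - 1 : ℕ) : ℚ) / q < (((δ - 1) / q : ℕ) : ℚ) + 1 := by
    rw [div_lt_iff₀ hq0]; exact_mod_cast h5
  have h7 : (((δ - 1) / q : ℕ) : ℚ) + (c + 1) = ((δ - 1 : ℕ) : ℚ) := by
    have : (δ - 1) / q + (c + 1) = δ - 1 := by omega
    exact_mod_cast this
  rw [mul_sub, mul_one_div, mul_one]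
  linarith

end BCH

/-- Existence of BCH subsystem codes for all co-subsystem
dimensions, Euclidean.  Let `n = q^m − 1` with `m ≥ 2` and let
`2 ≤ δ ≤ q^⌈m/2⌉ − 1 − (q−2)·[m odd]`.  Then for every `r` with
`0 ≤ r < n − 2m⌈(δ−1)(1−1/q)⌉` there exists an
`[[q^m − 1, n − 2m⌈(δ−1)(1−1/q)⌉ − r, r, d]]_q` Clifford subsystem code
with `d ≥ δ`. -/
theorem bch_subsystem_codes_all_r_euclidean
    (p : ℕ) (hp : p.Prime) (F : Type) [Field F] [Fintype F] [CharP F p]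
    (m n δ k : ℕ) (hm : 2 ≤ m)
    (hn : n = Fintype.card F ^ m - 1)
    (hδ1 : 2 ≤ δ)
    (hδ2 : δ ≤ Fintype.card F ^ ((m + 1) / 2) - 1 -
      (Fintype.card F - 2) * (if Odd m then 1 else 0))
    (hk : k = m * ⌈((δ : ℚ) - 1) * (1 - 1 / (Fintype.card F : ℚ))⌉₊) :
    ∀ r : ℕ, r < n - 2 * k →
      ∃ d : ℕ, δ ≤ d ∧
        ∃ Q : AddSubgroup ((Fin n → F) × (Fin n → F)),
          IsSubsysCode p Q (Fintype.card F ^ (n - 2 * k - r)) (Fintype.card F ^ r) d := by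
  intro r hr
  obtain ⟨A, hA, hAk, hAd⟩ := bch_exists p hp F m n δ hm hn hδ2
  refine subsys_of_selforth p hp A k δ r hA (hAk.trans ?_) hAd hr
  rw [hk]
  exact Nat.mul_le_mul_left _ (card_filter_bch _ δ Fintype.one_lt_card hδ1)
end

section
/- Existence of BCH subsystem codes for all co-subsystem dimensions (Hermitian): Let q be a prime power, m a positive integer, and let δ be an integer in the range 2 ≤ δ ≤ q^{m+[m even]} − 1 − (q^2 − 2)·[m even]. Then for every integer r with 0 ≤ r < q^{2m} − 1 − 2m⌈(δ−1)(1−1/q^2)⌉ there exists a Clifford subsystem code with parameters [[q^{2m} − 1, q^{2m} − 1 − 2m⌈(δ−1)(1−1/q^2)⌉ − r, r, d]]_q with minimum distance d ≥ δ that is pure up to δ. -/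
open Finset

namespace BCHSub

open LinearMap (BilinForm)

section LinAlg
variable {F V : Type} [Field F] [AddCommGroup V] [Module F V] [FiniteDimensional F V]

lemma extend_isotropic (B : BilinForm F V) (hB : B.Nondegenerate) (hA : B.IsAlt)
    (N : ℕ) (hN : Module.finrank F V = 2 * N) (D : Submodule F V) (hD : D ≤ B.orthogonal D)
    (t : ℕ) (ht : t ≤ N) (hDt : Module.finrank F D ≤ t) :
    ∃ D' : Submodule F V, D ≤ D' ∧ D' ≤ B.orthogonal D' ∧ Module.finrank F D' = t := by
  induction t, hDt using Nat.le_induction with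
  | base => exact ⟨D, le_rfl, hD, rfl⟩
  | succ t hDt ih =>
    obtain ⟨W, h1, h2, h3⟩ := ih (by omega)
    have h4 := LinearMap.BilinForm.finrank_orthogonal hB W
    have hlt : W < B.orthogonal W := lt_of_le_of_ne h2 (fun h => by
      rw [← h] at h4; omega)
    obtain ⟨x, hx, hxW⟩ := SetLike.exists_of_lt hlt
    refine ⟨W ⊔ Submodule.span F {x}, h1.trans le_sup_left, ?_, ?_⟩
    · intro y hy
      rw [LinearMap.BilinForm.mem_orthogonal_iff]
      intro z hz
      obtain ⟨w, hw, y', hy', rfl⟩ := Submodule.mem_sup.1 hy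
      obtain ⟨u, hu, z', hz', rfl⟩ := Submodule.mem_sup.1 hz
      obtain ⟨a, rfl⟩ := Submodule.mem_span_singleton.1 hy'
      obtain ⟨b, rfl⟩ := Submodule.mem_span_singleton.1 hz'
      have e1 : B u w = 0 := h2 hw u hu
      have e2 : B u x = 0 := hx u hu
      have e3 : B x w = 0 := (hA.isRefl w x (hx w hw))
      have e4 : B x x = 0 := hA x
      simp [e1, e2, e3, e4]
    · have h5 := Submodule.finrank_sup_add_finrank_inf_eq W (Submodule.span F {x})
      have h6 : W ⊓ Submodule.span F {x} = ⊥ := by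
        rw [eq_bot_iff]
        rintro y ⟨hy, hy'⟩
        obtain ⟨a, rfl⟩ := Submodule.mem_span_singleton.1 hy'
        by_cases ha : a = 0
        · simp [ha]
        · exact absurd ((Submodule.smul_mem_iff W ha).1 hy) hxW
      rw [h6, finrank_bot, finrank_span_singleton (by rintro rfl; exact hxW W.zero_mem)] at h5
      omega

lemma exists_gauge (B : BilinForm F V) (hB : B.Nondegenerate) (hA : B.IsAlt)
    (N : ℕ) (hN : Module.finrank F V = 2 * N) (D : Submodule F V) (hD : D ≤ B.orthogonal D)
    (r : ℕ) (hr : Module.finrank F D + r ≤ N) :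
    ∃ Q : Submodule F V, D ≤ Q ∧ Q ⊓ B.orthogonal Q = D ∧
      Module.finrank F Q = Module.finrank F D + 2 * r := by
  induction r with
  | zero => exact ⟨D, le_rfl, inf_eq_left.2 hD, rfl⟩
  | succ r ih =>
    obtain ⟨Q, h1, h2, h3⟩ := ih (by omega)
    have h4 := LinearMap.BilinForm.finrank_orthogonal hB Q
    have hDQ : D ≤ B.orthogonal Q := h2 ▸ inf_le_right
    have hlt : D < B.orthogonal Q := lt_of_le_of_ne hDQ (fun h => by
      rw [← h] at h4; omega)
    obtain ⟨x, hx, hxD⟩ := SetLike.exists_of_lt hlt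
    have hxQ : x ∉ Q := fun h => hxD (h2 ▸ ⟨h, hx⟩)
    obtain ⟨y, hy, hyx⟩ : ∃ y ∈ B.orthogonal Q, B y x ≠ 0 := by
      by_contra! h
      apply hxQ
      rw [← LinearMap.BilinForm.orthogonal_orthogonal hB hA.isRefl Q]
      exact fun y hy => h y hy
    have hxx : B x x = 0 := hA x
    have hyy : B y y = 0 := hA y
    have hxy : B x y ≠ 0 := fun h => hyx (hA.isRefl _ _ h)
    have ex : ∀ u ∈ Q, B u x = 0 := fun u hu => hx u hu
    have ey : ∀ u ∈ Q, B u y = 0 := fun u hu => hy u hu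
    have ex' : ∀ u ∈ Q, B x u = 0 := fun u hu => hA.isRefl _ _ (hx u hu)
    have ey' : ∀ u ∈ Q, B y u = 0 := fun u hu => hA.isRefl _ _ (hy u hu)
    refine ⟨Q ⊔ Submodule.span F {x, y}, h1.trans le_sup_left, ?_, ?_⟩
    · apply le_antisymm
      · rintro z ⟨hz, hz'⟩
        obtain ⟨u, hu, v, hv, rfl⟩ := Submodule.mem_sup.1 hz
        obtain ⟨a, b, rfl⟩ := Submodule.mem_span_pair.1 hv
        have k1 : B x (u + (a • x + b • y)) = 0 := hz' x
          (Submodule.mem_sup_right (Submodule.subset_span (by simp)))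
        have k2 : B y (u + (a • x + b • y)) = 0 := hz' y
          (Submodule.mem_sup_right (Submodule.subset_span (by simp)))
        simp [ex' u hu, hxx, hxy] at k1
        simp [ey' u hu, hyy, hyx] at k2
        subst k1 k2
        rw [← h2]
        refine ⟨by simpa using hu, fun w hw => ?_⟩
        exact hz' w (Submodule.mem_sup_left hw)
      · intro z hz
        refine ⟨Submodule.mem_sup_left (h1 hz), fun w hw => ?_⟩
        obtain ⟨u, hu, v, hv, rfl⟩ := Submodule.mem_sup.1 hw
        obtain ⟨a, b, rfl⟩ := Submodule.mem_span_pair.1 hv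
        have : B u z = 0 := hDQ hz u hu
        simp [this, ex' z (h1 hz), ey' z (h1 hz)]
    · have h5 := Submodule.finrank_sup_add_finrank_inf_eq Q (Submodule.span F {x, y})
      have h6 : Q ⊓ Submodule.span F {x, y} = ⊥ := by
        rw [eq_bot_iff]
        rintro z ⟨hz, hz'⟩
        obtain ⟨a, b, rfl⟩ := Submodule.mem_span_pair.1 hz'
        have k1 := ex' _ hz
        have k2 := ey' _ hz
        simp [hxx, hxy] at k1
        simp [hyy, hyx] at k2
        simp [k1, k2]
      have h7 : LinearIndependent F ![x, y] := by
        rw [LinearIndependent.pair_iff]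
        intro a b hab
        have k1 : B x (a • x + b • y) = 0 := by rw [hab]; simp
        have k2 : B y (a • x + b • y) = 0 := by rw [hab]; simp
        simp [hxx, hxy] at k1
        simp [hyy, hyx] at k2
        exact ⟨k2, k1⟩
      have h8 := finrank_span_eq_card h7
      rw [Matrix.range_cons_cons_empty, Fintype.card_fin] at h8
      rw [h6, finrank_bot, h8] at h5
      omega
end LinAlg

section Form
variable (F : Type) [Field F] (n : ℕ)

/-- The (untraced) symplectic form. -/
noncomputable def sB : BilinForm F ((Fin n → F) × (Fin n → F)) :=
  LinearMap.mk₂ F (fun u v => ∑ i, (v.1 i * u.2 i - u.1 i * v.2 i))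
    (by intros; rw [← Finset.sum_add_distrib]; refine Finset.sum_congr rfl fun i _ => ?_
        simp; ring)
    (by intros; rw [smul_eq_mul, Finset.mul_sum]; refine Finset.sum_congr rfl fun i _ => ?_
        simp; ring)
    (by intros; rw [← Finset.sum_add_distrib]; refine Finset.sum_congr rfl fun i _ => ?_
        simp; ring)
    (by intros; rw [smul_eq_mul, Finset.mul_sum]; refine Finset.sum_congr rfl fun i _ => ?_
        simp; ring)

variable {F n}

lemma sB_apply (u v : (Fin n → F) × (Fin n → F)) :
    sB F n u v = ∑ i, (v.1 i * u.2 i - u.1 i * v.2 i) := rfl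

lemma sB_alt : (sB F n).IsAlt := by
  intro u
  rw [sB_apply]
  exact Finset.sum_eq_zero fun i _ => by ring

lemma sB_nondeg : (sB F n).Nondegenerate := by
  classical
  suffices h : ∀ u, (∀ v, sB F n u v = 0) → u = 0 from
    ⟨h, fun u hu => h u fun v => sB_alt.isRefl _ _ (hu v)⟩
  intro u hu
  have h1 : u.1 = 0 := by
    ext j
    simpa [sB_apply, Pi.single_apply] using hu (0, Pi.single j 1)
  have h2 : u.2 = 0 := by
    ext j
    simpa [sB_apply, Pi.single_apply] using hu (Pi.single j 1, 0)
  exact Prod.ext h1 h2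

lemma sympDual_eq (p : ℕ) [Fact p.Prime] [Fintype F] [CharP F p]
    (W : Submodule F ((Fin n → F) × (Fin n → F))) :
    sympDual p (W : Set ((Fin n → F) × (Fin n → F))) = ((sB F n).orthogonal W : Set _) := by
  letI := ZMod.algebra F p
  ext v
  constructor
  · intro hv w hw
    apply sB_alt.isRefl
    by_contra hne
    have hnd := traceForm_nondegenerate (ZMod p) F
    apply hne
    apply hnd.1
    intro c
    have := hv (c • w) (W.smul_mem c hw)
    rw [Algebra.traceForm_apply]
    have e : sB F n v w * c = sB F n v (c • w) := by simp [mul_comm]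
    rw [e]
    exact this
  · intro hv w hw
    have : sB F n v w = 0 := sB_alt.isRefl _ _ (hv w hw)
    rw [sB_apply] at this
    simp only [trSympForm]
    rw [this, map_zero]
end Form

section Arith

lemma not_dvd_aux (q m δ s t j : ℕ) (hq : 2 ≤ q) (hm : 0 < m)
    (hδ2 : δ ≤ q ^ (m + (if Even m then 1 else 0)) - 1 -
      (q ^ 2 - 2) * (if Even m then 1 else 0))
    (hs : s < δ) (ht1 : 1 ≤ t) (ht : t < δ) (hj : Odd j) (hjm : j ≤ m) :
    ¬ (q ^ (2 * m) - 1 ∣ t + s * q ^ j) := by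
  have key : t + s * q ^ j < q ^ (2 * m) - 1 := by
    by_cases he : Even m
    · simp only [he, if_true, mul_one] at hδ2
      have hj' : j ≤ m - 1 := by
        rcases Nat.lt_or_ge j m with h | h
        · omega
        · have : j = m := le_antisymm hjm h
          subst this
          exact absurd he (Nat.not_even_iff_odd.2 hj)
      have h1 : q ^ j ≤ q ^ (m - 1) := Nat.pow_le_pow_right (by omega) hj'
      obtain ⟨a, rfl⟩ : ∃ a, m = a + 1 := ⟨m - 1, by omega⟩
      simp only [Nat.add_sub_cancel] at h1
      have hQ : q ^ 2 ≤ q ^ (a + 1 + 1) := Nat.pow_le_pow_right (by omega) (by omega)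
      have hQ4 : 4 ≤ q ^ 2 := by nlinarith
      have hs' : s + q ^ 2 ≤ q ^ (a + 1 + 1) := by omega
      have ht' : t + q ^ 2 ≤ q ^ (a + 1 + 1) := by omega
      have e1 : q ^ (a + 1 + 1) = q ^ 2 * q ^ a := by ring
      have e2 : q ^ (2 * (a + 1)) = q ^ 2 * (q ^ a * q ^ a) := by ring
      rw [e1] at hs' ht'
      rw [e2]
      have h2 : s * q ^ j ≤ s * q ^ a := Nat.mul_le_mul_left _ h1
      have h3 : (s + q ^ 2) * q ^ a ≤ q ^ 2 * q ^ a * q ^ a := Nat.mul_le_mul_right _ hs'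
      rw [Nat.lt_sub_iff_add_lt]
      nlinarith
    · simp only [he, if_false, mul_zero, add_zero, Nat.sub_zero] at hδ2
      have h1 : q ^ j ≤ q ^ m := Nat.pow_le_pow_right (by omega) hjm
      have h2 : s * q ^ j ≤ s * q ^ m := Nat.mul_le_mul_left _ h1
      have hs' : s + 2 ≤ q ^ m := by omega
      have ht' : t + 2 ≤ q ^ m := by omega
      have e2 : q ^ (2 * m) = q ^ m * q ^ m := by ring
      have h3 : (s + 2) * q ^ m ≤ q ^ m * q ^ m := Nat.mul_le_mul_right _ hs'
      rw [e2, Nat.lt_sub_iff_add_lt]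
      nlinarith
  exact Nat.not_dvd_of_pos_of_lt (by omega) key

lemma not_dvd (q m δ s t j : ℕ) (hq : 2 ≤ q) (hm : 0 < m)
    (hδ2 : δ ≤ q ^ (m + (if Even m then 1 else 0)) - 1 -
      (q ^ 2 - 2) * (if Even m then 1 else 0))
    (hs1 : 1 ≤ s) (hs : s < δ) (ht1 : 1 ≤ t) (ht : t < δ) (hj : Odd j) (hjm : j < 2 * m) :
    ¬ (q ^ (2 * m) - 1 ∣ t + s * q ^ j) := by
  rcases Nat.lt_or_ge m j with h | h
  · intro hd
    apply not_dvd_aux q m δ t s (2 * m - j) hq hm hδ2 ht hs1 hs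
      (Nat.Even.sub_odd hjm.le (by simp) hj) (by omega)
    have h1 := Dvd.dvd.mul_right hd (q ^ (2 * m - j))
    have h2 : (t + s * q ^ j) * q ^ (2 * m - j)
        = (s + t * q ^ (2 * m - j)) + (q ^ (2 * m) - 1) * s := by
      have e : q ^ j * q ^ (2 * m - j) = q ^ (2 * m) := by
        rw [← pow_add]; congr 1; omega
      have e1 : 1 ≤ q ^ (2 * m) := Nat.one_le_pow _ _ (by omega)
      obtain ⟨c, hc⟩ := Nat.exists_eq_add_of_le e1
      rw [add_mul, mul_assoc, e, hc, Nat.add_sub_cancel_left]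
      ring
    rw [h2] at h1
    exact (Nat.dvd_add_left (Dvd.intro _ rfl)).1 h1
  · exact not_dvd_aux q m δ s t j hq hm hδ2 hs ht1 ht hj h

/-- The exponents used. -/
def expS (q δ : ℕ) : Finset ℕ := {s ∈ Finset.Ioc 0 (δ - 1) | ¬ q ^ 2 ∣ s}

lemma card_expS (q δ : ℕ) (hq : 2 ≤ q) (hδ : 2 ≤ δ) :
    (expS q δ).card ≤ ⌈((δ : ℚ) - 1) * (1 - 1 / ((q : ℚ) ^ 2))⌉₊ := by
  have h1 := Nat.Ioc_filter_dvd_card_eq_div (δ - 1) (q ^ 2)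
  have h2 := Finset.card_filter_add_card_filter_not (s := Finset.Ioc 0 (δ - 1))
    (fun s => q ^ 2 ∣ s)
  rw [h1, Nat.card_Ioc] at h2
  change _ + (expS q δ).card = _ at h2
  obtain ⟨N, hN⟩ : ∃ N, N = (expS q δ).card := ⟨_, rfl⟩
  rw [← hN] at h2 ⊢
  obtain ⟨D, rfl⟩ : ∃ D, δ = D + 1 := ⟨δ - 1, by omega⟩
  simp only [Nat.add_sub_cancel, Nat.sub_zero] at h2
  rcases Nat.eq_zero_or_pos N with h0 | h0
  · omega
  obtain ⟨M, rfl⟩ : ∃ M, N = M + 1 := ⟨N - 1, by omega⟩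
  rw [Nat.succ_le_iff, Nat.lt_ceil]
  have hQ : 0 < q ^ 2 := by positivity
  have h3 : D < q ^ 2 * (D / q ^ 2 + 1) := Nat.lt_mul_div_succ D hQ
  have h3' : (D : ℚ) / (q : ℚ) ^ 2 < (D / q ^ 2 : ℕ) + 1 := by
    rw [div_lt_iff₀ (by exact_mod_cast hQ), mul_comm]
    exact_mod_cast h3
  have h2' : ((D / q ^ 2 : ℕ) : ℚ) + (M + 1) = D := by exact_mod_cast h2
  push_cast at *
  have : ((D : ℚ) + 1 - 1) * (1 - 1 / (q : ℚ) ^ 2) = D - D / (q : ℚ) ^ 2 := by ring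
  rw [this]
  linarith

end Arith

section BCH

lemma bch_bound {L : Type} [Field L] {n : ℕ} (α : Fin n → L) (hα : Function.Injective α)
    (hα0 : ∀ i, α i ≠ 0) (w : Fin n → L) (δ : ℕ)
    (h : ∀ s, 1 ≤ s → s < δ → ∑ i, α i ^ s * w i = 0) (hw : {i | w i ≠ 0}.ncard < δ) :
    w = 0 := by
  classical
  by_contra hne
  obtain ⟨i0, hi0⟩ := Function.ne_iff.1 hne
  simp only [Pi.zero_apply] at hi0
  let T : Finset (Fin n) := {i | w i ≠ 0}
  have hT : T.card < δ := by
    convert hw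
    rw [← Set.ncard_coe_finset]
    congr 1
    ext; simp [T]
  have hi0T : i0 ∈ T := by simp [T, hi0]
  have hTe := Finset.card_erase_add_one hi0T
  let f : Polynomial L := ∏ j ∈ T.erase i0, (Polynomial.X - Polynomial.C (α j))
  have hf : f.natDegree = (T.erase i0).card := by
    simp [f, Polynomial.natDegree_finsetProd_X_sub_C_eq_card]
  have h1 : ∑ i, α i * f.eval (α i) * w i = 0 := by
    have : ∀ i, α i * f.eval (α i) * w i
        = ∑ s ∈ Finset.range (f.natDegree + 1), f.coeff s * (α i ^ (s + 1) * w i) := by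
      intro i
      rw [Polynomial.eval_eq_sum_range, Finset.mul_sum, Finset.sum_mul]
      refine Finset.sum_congr rfl fun s _ => by ring
    simp_rw [this]
    rw [Finset.sum_comm]
    refine Finset.sum_eq_zero fun s hs => ?_
    rw [← Finset.mul_sum, h (s + 1) (by omega), mul_zero]
    rw [Finset.mem_range] at hs
    omega
  have h2 : ∑ i, α i * f.eval (α i) * w i = α i0 * f.eval (α i0) * w i0 := by
    refine Finset.sum_eq_single i0 (fun j _ hj => ?_) (by simp)
    by_cases hjT : j ∈ T
    · have : f.eval (α j) = 0 := by
        rw [Polynomial.eval_prod]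
        exact Finset.prod_eq_zero (Finset.mem_erase.2 ⟨hj, hjT⟩) (by simp)
      simp [this]
    · have : w j = 0 := by simpa [T] using hjT
      simp [this]
  rw [h2] at h1
  have h3 : f.eval (α i0) ≠ 0 := by
    rw [Polynomial.eval_prod, Finset.prod_ne_zero_iff]
    intro j hj
    simp only [Polynomial.eval_sub, Polynomial.eval_X, Polynomial.eval_C]
    rw [sub_ne_zero]
    exact fun e => (Finset.mem_erase.1 hj).1 (hα e).symm
  exact mul_ne_zero (mul_ne_zero (hα0 i0) h3) hi0 h1

/-- From exponents not divisible by `Q` to all exponents. -/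
lemma all_exps {L : Type} [Field L] {n : ℕ} (α : Fin n → L) (w : Fin n → L) (q δ e p: ℕ)
    (hq : 2 ≤ q) [hp : Fact p.Prime] [CharP L p] (hqe : q ^ 2 = p ^ e)
    (hw : ∀ i, w i ^ (q ^ 2) = w i)
    (h : ∀ s ∈ expS q δ, ∑ i, α i ^ s * w i = 0) :
    ∀ s, 1 ≤ s → s < δ → ∑ i, α i ^ s * w i = 0 := by
  intro s
  induction s using Nat.strong_induction_on with
  | _ s ih =>
    intro h1 h2
    by_cases hd : q ^ 2 ∣ s
    · obtain ⟨t, rfl⟩ := hd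
      have hq2 : 2 ≤ q ^ 2 := by nlinarith
      have ht : 1 ≤ t := by
        rcases Nat.eq_zero_or_pos t with h0 | h0
        · simp [h0] at h1
        · exact h0
      have h3 := ih t (by nlinarith) ht (by nlinarith)
      have h4 : ∑ i, α i ^ (q ^ 2 * t) * w i = (∑ i, α i ^ t * w i) ^ (q ^ 2) := by
        rw [hqe, sum_pow_char_pow, ← hqe]
        refine Finset.sum_congr rfl fun i _ => ?_
        rw [mul_pow, hw, ← pow_mul, mul_comm t]
      rw [h4, h3, zero_pow (by omega)]
    · apply h
      simp only [expS, Finset.mem_filter, Finset.mem_Ioc]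
      exact ⟨⟨h1, by omega⟩, hd⟩

end BCH

section Code

lemma exists_D (p : ℕ) [Fact p.Prime] (F : Type) [Field F] [Fintype F] [CharP F p]
    (L : Type) [Field L] [Finite L] [Algebra F L]
    (m n δ : ℕ) (hm : 0 < m)
    (hL : Module.finrank F L = 2 * m)
    (hn : n = Fintype.card F ^ (2 * m) - 1)
    (hδ2 : δ ≤ Fintype.card F ^ (m + (if Even m then 1 else 0)) - 1 -
      (Fintype.card F ^ 2 - 2) * (if Even m then 1 else 0)) :
    ∃ D : Submodule F ((Fin n → F) × (Fin n → F)), D ≤ (sB F n).orthogonal D ∧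
      Module.finrank F D ≤ 2 * (m * (expS (Fintype.card F) δ).card) ∧
      ∀ v ∈ (sB F n).orthogonal D, v ≠ 0 → δ ≤ swt v := by
  classical
  let : Fintype L := Fintype.ofFinite L
  obtain ⟨q, hqdef⟩ : ∃ q, q = Fintype.card F := ⟨_, rfl⟩
  rw [← hqdef] at hn hδ2 ⊢
  have hq : 2 ≤ q := hqdef ▸ Fintype.one_lt_card
  have hcardL : Fintype.card L = q ^ (2 * m) := by
    rw [hqdef, Module.card_eq_pow_finrank (K := F) (V := L), hL]
  have : CharP L p := charP_of_injective_algebraMap (algebraMap F L).injective p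
  obtain ⟨f, hf⟩ : ∃ f, q = p ^ f := by
    obtain ⟨f, _, h⟩ := FiniteField.card F p
    exact ⟨f, hqdef ▸ h⟩
  have hFq : ∀ a : F, (algebraMap F L a) ^ q = algebraMap F L a := by
    intro a
    rw [← map_pow, hqdef, FiniteField.pow_card]
  -- evaluation points
  have hcu : Fintype.card Lˣ = n := by rw [Fintype.card_units, hcardL, hn]
  let ε : Fin n ≃ Lˣ := (Fintype.equivFinOfCardEq hcu).symm
  let α : Fin n → L := fun i => (ε i : L)
  have hα : Function.Injective α := fun i j h => ε.injective (Units.ext h)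
  have hα0 : ∀ i, α i ≠ 0 := fun i => (ε i).ne_zero
  have hsum : ∀ e, ¬ (q ^ (2 * m) - 1 ∣ e) → ∑ i, α i ^ e = 0 := by
    intro e he
    have h1 := FiniteField.sum_pow_units L e
    rw [hcardL, if_neg he] at h1
    rw [← h1]
    exact Fintype.sum_equiv ε _ _ (fun i => by simp [α])
  -- the element ω
  obtain ⟨ω, hω2, hω1⟩ : ∃ ω : L, ω ^ (q ^ 2) = ω ∧ ω ^ q ≠ ω := by
    obtain ⟨g, hg⟩ := IsCyclic.exists_generator (α := Lˣ)
    have hog : orderOf g = q ^ (2 * m) - 1 := by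
      rw [orderOf_eq_card_of_forall_mem_zpowers hg, Nat.card_eq_fintype_card, hcu, hn]
    have hdvd : q ^ 2 - 1 ∣ q ^ (2 * m) - 1 := by
      rw [pow_mul]
      simpa using Nat.sub_dvd_pow_sub_pow (q ^ 2) 1 m
    obtain ⟨c, hc⟩ := hdvd
    have hq2 : 4 ≤ q ^ 2 := by nlinarith
    have hqm : 1 < q ^ (2 * m) := Nat.one_lt_pow (by omega) (by omega)
    have hc0 : 0 < c := by
      rcases Nat.eq_zero_or_pos c with h | h
      · rw [h, mul_zero] at hc; omega
      · exact h
    refine ⟨((g ^ c : Lˣ) : L), ?_, ?_⟩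
    · rw [← Units.val_pow_eq_pow_val]
      congr 1
      obtain ⟨b, hb⟩ : ∃ b, q ^ 2 = b + 1 := ⟨q ^ 2 - 1, by omega⟩
      have : (g ^ c) ^ b = 1 := by
        rw [← pow_mul, ← orderOf_dvd_iff_pow_eq_one, hog, hc, hb, Nat.add_sub_cancel, mul_comm]
      rw [hb, pow_succ, this, one_mul]
    · intro h
      rw [← Units.val_pow_eq_pow_val] at h
      have h := Units.ext h
      obtain ⟨b, rfl⟩ : ∃ b, q = b + 1 := ⟨q - 1, by omega⟩
      rw [pow_succ, mul_eq_right, ← pow_mul, ← orderOf_dvd_iff_pow_eq_one, hog, hc] at h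
      have h3 := Nat.le_of_dvd (Nat.mul_pos hc0 (by omega)) h
      rw [mul_comm] at h3
      have h4 := Nat.le_of_mul_le_mul_left h3 hc0
      have : b + 1 < (b + 1) ^ 2 := by nlinarith
      omega
  have hωeven : ∀ j, Even j → ω ^ (q ^ j) = ω := by
    rintro j ⟨i, rfl⟩
    induction i with
    | zero => simp
    | succ i ih =>
      have : q ^ (i + 1 + (i + 1)) = q ^ (i + i) * q ^ 2 := by ring
      rw [this, pow_mul, ih, hω2]
  -- the code
  let S := expS q δ
  let P : Fin n → (S → L) → L := fun i c => ∑ s : S, c s * α i ^ (s : ℕ)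
  have P_add : ∀ i c d, P i (c + d) = P i c + P i d := by
    intro i c d
    simp [P, add_mul, Finset.sum_add_distrib]
  have P_smul : ∀ i (a : F) c, P i (a • c) = a • P i c := by
    intro i a c
    simp [P, Finset.smul_sum]
  let G : (S → L) →ₗ[F] ((Fin n → F) × (Fin n → F)) :=
    { toFun := fun c => (fun i => -Algebra.trace F L (ω * P i c), fun i => Algebra.trace F L (P i c))
      map_add' := by
        intro c d
        ext i
        · simp [P_add, mul_add, add_comm]
        · simp [P_add]
      map_smul' := by
        intro a c
        ext i
        · simp [P_smul]
        · simp [P_smul] }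
  let W : ((Fin n → F) × (Fin n → F)) → Fin n → L :=
    fun v i => algebraMap F L (v.1 i) + algebraMap F L (v.2 i) * ω
  have hBG : ∀ c v, sB F n (G c) v = Algebra.trace F L (∑ i, P i c * W v i) := by
    intro c v
    rw [sB_apply, map_sum]
    refine Finset.sum_congr rfl fun i _ => ?_
    have : P i c * W v i = v.1 i • P i c + v.2 i • (ω * P i c) := by
      simp only [W, Algebra.smul_def]; ring
    rw [this, map_add, map_smul, map_smul]
    simp only [G, LinearMap.coe_mk, AddHom.coe_mk, smul_eq_mul]
    ring
  have hcrit : ∀ v, v ∈ (sB F n).orthogonal (LinearMap.range G) ↔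
      ∀ s ∈ S, ∑ i, α i ^ s * W v i = 0 := by
    intro v
    constructor
    · intro hv s hs
      apply (traceForm_nondegenerate F L).1
      intro c
      have h1 : sB F n (G (Pi.single ⟨s, hs⟩ c)) v = 0 := hv _ ⟨_, rfl⟩
      rw [hBG] at h1
      rw [Algebra.traceForm_apply, ← h1, Finset.sum_mul]
      congr 1
      refine Finset.sum_congr rfl fun i _ => ?_
      have : P i (Pi.single ⟨s, hs⟩ c) = c * α i ^ s := by
        simp only [P]
        rw [Finset.sum_eq_single ⟨s, hs⟩]
        · simp
        · intro b _ hb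
          simp [Pi.single_eq_of_ne hb]
        · simp
      rw [this]; ring
    · rintro hv _ ⟨c, rfl⟩
      change sB F n (G c) v = 0
      rw [hBG]
      have : ∑ i, P i c * W v i = 0 := by
        simp only [P, Finset.sum_mul]
        rw [Finset.sum_comm]
        refine Finset.sum_eq_zero fun s _ => ?_
        have h1 := hv s s.2
        calc ∑ i, c s * α i ^ (s : ℕ) * W v i = c s * ∑ i, α i ^ (s : ℕ) * W v i := by
              rw [Finset.mul_sum]
              exact Finset.sum_congr rfl fun i _ => by ring
          _ = 0 := by rw [h1, mul_zero]
      rw [this, map_zero]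
  have hSmem : ∀ s ∈ S, 1 ≤ s ∧ s < δ := by
    intro s hs
    simp only [S, expS, Finset.mem_filter, Finset.mem_Ioc] at hs
    omega
  refine ⟨LinearMap.range G, ?_, ?_, ?_⟩
  · rintro _ ⟨c, rfl⟩
    rw [hcrit]
    intro t ht
    have hWG : ∀ i, W (G c) i = ∑ j ∈ Finset.range (2 * m), ∑ s : S,
        (ω - ω ^ (q ^ j)) * (c s ^ (q ^ j) * α i ^ ((s : ℕ) * q ^ j)) := by
      intro i
      simp only [W, G, LinearMap.coe_mk, AddHom.coe_mk, map_neg]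
      rw [FiniteField.algebraMap_trace_eq_sum_pow, FiniteField.algebraMap_trace_eq_sum_pow, hL,
        Nat.card_eq_fintype_card, ← hqdef, ← Finset.sum_neg_distrib, Finset.sum_mul,
        ← Finset.sum_add_distrib]
      refine Finset.sum_congr rfl fun j _ => ?_
      rw [← Finset.mul_sum]
      have : P i c ^ (q ^ j) = ∑ s : S, c s ^ (q ^ j) * α i ^ ((s : ℕ) * q ^ j) := by
        have e : q ^ j = p ^ (f * j) := by rw [hf, pow_mul]
        simp only [P]
        rw [e, sum_pow_char_pow]
        refine Finset.sum_congr rfl fun s _ => ?_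
        rw [mul_pow, pow_mul (α i)]
      rw [← this, mul_pow]
      ring
    simp_rw [hWG, Finset.mul_sum]
    rw [Finset.sum_comm]
    refine Finset.sum_eq_zero fun j hj => ?_
    rw [Finset.sum_comm]
    refine Finset.sum_eq_zero fun s _ => ?_
    by_cases hje : Even j
    · simp [hωeven j hje]
    · have h0 := hsum (t + s * q ^ j) (not_dvd q m δ s t j hq hm hδ2 (hSmem s s.2).1 (hSmem s s.2).2
        (hSmem t ht).1 (hSmem t ht).2 (Nat.not_even_iff_odd.1 hje) (Finset.mem_range.1 hj))
      calc ∑ i, α i ^ t * ((ω - ω ^ (q ^ j)) * (c s ^ (q ^ j) * α i ^ ((s : ℕ) * q ^ j)))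
          = (ω - ω ^ (q ^ j)) * c s ^ (q ^ j) * ∑ i, α i ^ (t + s * q ^ j) := by
            rw [Finset.mul_sum]
            exact Finset.sum_congr rfl fun i _ => by rw [pow_add]; ring
        _ = 0 := by rw [h0, mul_zero]
  · refine (LinearMap.finrank_range_le G).trans ?_
    rw [Module.finrank_pi_fintype]
    simp [hL, S]
    apply le_of_eq; ring
  · intro v hv hv0
    rw [hcrit] at hv
    by_contra! hlt
    have hq2e : q ^ 2 = p ^ (f * 2) := by rw [hf, pow_mul]
    have hWQ : ∀ i, W v i ^ (q ^ 2) = W v i := by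
      intro i
      have h1 : ∀ a : F, (algebraMap F L a) ^ (q ^ 2) = algebraMap F L a := by
        intro a; rw [sq, pow_mul, hFq, hFq]
      simp only [W]
      rw [hq2e, add_pow_char_pow, ← hq2e, mul_pow, h1, h1, hω2]
    have hWzero : ∀ i, W v i = 0 ↔ (v.1 i = 0 ∧ v.2 i = 0) := by
      intro i
      constructor
      · intro h
        have hb : v.2 i = 0 := by
          by_contra hb
          apply hω1
          have hb' : algebraMap F L (v.2 i) ≠ 0 := by simpa using hb
          have : ω = algebraMap F L (- v.1 i / v.2 i) := by
            rw [map_div₀, map_neg, eq_div_iff hb']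
            simp only [W] at h
            linear_combination h
          rw [this, hFq]
        simp only [W, hb] at h
        exact ⟨by simpa using h, hb⟩
      · rintro ⟨h1, h2⟩
        simp [W, h1, h2]
    have hW0 : W v = 0 := by
      refine bch_bound α hα hα0 (W v) δ
        (all_exps α (W v) q δ (f * 2) p hq hq2e hWQ hv) ?_
      have e : {i | W v i ≠ 0}.ncard = swt v := by
        unfold swt
        congr 1
        ext i
        exact not_congr (hWzero i)
      rw [e]
      exact hlt
    apply hv0
    have : ∀ i, v.1 i = 0 ∧ v.2 i = 0 := fun i => (hWzero i).1 (congrFun hW0 i)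
    exact Prod.ext (funext fun i => (this i).1) (funext fun i => (this i).2)

end Code

end BCHSub

/-- Existence of BCH subsystem codes for all co-subsystem
dimensions, Hermitian.  Let `m` be positive, `n = q^{2m} − 1` and let
`2 ≤ δ ≤ q^{m+[m even]} − 1 − (q^2−2)·[m even]`.  Then for every `r` with
`0 ≤ r < n − 2m⌈(δ−1)(1−1/q^2)⌉` there exists an
`[[q^{2m} − 1, n − 2m⌈(δ−1)(1−1/q^2)⌉ − r, r, d]]_q` Clifford subsystem
code with `d ≥ δ` that is pure up to `δ`. -/
theorem bch_subsystem_codes_all_r_hermitian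
    (p : ℕ) (hp : p.Prime) (F : Type) [Field F] [Fintype F] [CharP F p]
    (m n δ k : ℕ) (hm : 0 < m)
    (hn : n = Fintype.card F ^ (2 * m) - 1)
    (hδ1 : 2 ≤ δ)
    (hδ2 : δ ≤ Fintype.card F ^ (m + (if Even m then 1 else 0)) - 1 -
      (Fintype.card F ^ 2 - 2) * (if Even m then 1 else 0))
    (hk : k = m * ⌈((δ : ℚ) - 1) * (1 - 1 / ((Fintype.card F : ℚ) ^ 2))⌉₊) :
    ∀ r : ℕ, r < n - 2 * k →
      ∃ d : ℕ, δ ≤ d ∧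
        ∃ Q : AddSubgroup ((Fin n → F) × (Fin n → F)),
          IsSubsysCode p Q (Fintype.card F ^ (n - 2 * k - r)) (Fintype.card F ^ r) d ∧
          PureTo Q δ := by
  have : Fact p.Prime := ⟨hp⟩
  intro r hr
  have : NeZero (2 * m) := ⟨by omega⟩
  have hq : 2 ≤ Fintype.card F := Fintype.one_lt_card
  obtain ⟨D0, h1, h2, h3⟩ := BCHSub.exists_D p F (FiniteField.Extension F p (2 * m)) m n δ hm
    (FiniteField.finrank_extension F p (2 * m)) hn hδ2
  have hk2 : 2 * (m * (BCHSub.expS (Fintype.card F) δ).card) ≤ 2 * k := by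
    rw [hk]
    exact Nat.mul_le_mul_left _ (Nat.mul_le_mul_left _ (BCHSub.card_expS _ δ hq hδ1))
  have hV : Module.finrank F ((Fin n → F) × (Fin n → F)) = 2 * n := by
    simp [two_mul]
  obtain ⟨D, hD0, hD, hDk⟩ := BCHSub.extend_isotropic (BCHSub.sB F n) BCHSub.sB_nondeg
    BCHSub.sB_alt n hV D0 h1 (2 * k) (by omega) (h2.trans hk2)
  obtain ⟨Q, hDQ, hQ, hQk⟩ := BCHSub.exists_gauge (BCHSub.sB F n) BCHSub.sB_nondeg
    BCHSub.sB_alt n hV D hD r (by omega)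
  have hQD : Q ≤ (BCHSub.sB F n).orthogonal D := by
    rw [← LinearMap.BilinForm.orthogonal_orthogonal BCHSub.sB_nondeg BCHSub.sB_alt.isRefl Q]
    exact LinearMap.BilinForm.orthogonal_le (hQ ▸ inf_le_right)
  have hwt : ∀ v ∈ (BCHSub.sB F n).orthogonal D, v ≠ 0 → δ ≤ swt v := fun v hv =>
    h3 v (LinearMap.BilinForm.orthogonal_le hD0 hv)
  have hDs : ((Q.toAddSubgroup : Set ((Fin n → F) × (Fin n → F))) ∩
      sympDual p (Q.toAddSubgroup : Set ((Fin n → F) × (Fin n → F)))) = (D : Set _) := by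
    rw [Submodule.coe_toAddSubgroup, BCHSub.sympDual_eq, ← hQ]
    rfl
  have hfo := LinearMap.BilinForm.finrank_orthogonal (BCHSub.sB_nondeg (F := F) (n := n)) D
  have hlt : Q < (BCHSub.sB F n).orthogonal D := lt_of_le_of_ne hQD (fun h => by
    rw [← h] at hfo; omega)
  obtain ⟨x, hx, hxQ⟩ := SetLike.exists_of_lt hlt
  have hne : ((BCHSub.sB F n).orthogonal D : Set ((Fin n → F) × (Fin n → F)))
      ≠ (Q.toAddSubgroup : Set _) := fun h => hxQ (by
    have : x ∈ (Q.toAddSubgroup : Set ((Fin n → F) × (Fin n → F))) := h ▸ hx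
    exact this)
  have hcard : ∀ W : Submodule F ((Fin n → F) × (Fin n → F)),
      Nat.card W = Fintype.card F ^ Module.finrank F W := by
    intro W
    rw [Module.natCard_eq_pow_finrank (K := F), Nat.card_eq_fintype_card]
  refine ⟨minSwt (((BCHSub.sB F n).orthogonal D : Set ((Fin n → F) × (Fin n → F))) \
    (Q.toAddSubgroup : Set ((Fin n → F) × (Fin n → F)))), ?_,
    Q.toAddSubgroup, ?_, fun v hv => hwt v (hQD hv)⟩
  · have hmem := Nat.sInf_mem (s := swt '' ((((BCHSub.sB F n).orthogonal D :
        Set ((Fin n → F) × (Fin n → F))) \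
      (Q.toAddSubgroup : Set ((Fin n → F) × (Fin n → F)))) \ {0}))
      ⟨_, x, ⟨⟨hx, hxQ⟩, fun h => hxQ (by rw [Set.mem_singleton_iff.1 h]; exact Q.zero_mem)⟩, rfl⟩
    obtain ⟨v, ⟨⟨hv, _⟩, hv0⟩, hv'⟩ := hmem
    rw [minSwt, ← hv']
    exact hwt v hv hv0
  · simp only [IsSubsysCode]
    rw [hDs, BCHSub.sympDual_eq]
    refine ⟨?_, ?_, fun h => absurd h hne, fun _ => rfl⟩
    · have := hcard D
      rw [hDk] at this
      rw [show Nat.card (D : Set ((Fin n → F) × (Fin n → F))) = _ from this, ← pow_add, ← pow_add]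
      congr 1; omega
    · have := hcard Q
      rw [hQk, hDk] at this
      rw [show Nat.card Q.toAddSubgroup = _ from this, ← pow_add, ← pow_add]
      congr 1; omega
end

section
/- MDS subsystem codes from MDS stabilizer codes: If there exists an F_q-linear [[n,k,d]]_q MDS stabilizer code (i.e., one with k = n − 2d + 2), then for every r in the range 0 ≤ r ≤ k there exists a pure F_q-linear [[n, k−r, r, d]]_q MDS Clifford subsystem code, i.e., one whose parameters satisfy (k − r) + r = n − 2d + 2 and whose minimum distance is exactly d. -/
open Finset

namespace MDSAux

variable {F : Type} [Field F] {n : ℕ}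

/-- The ambient space. -/
abbrev Vv (F : Type) (n : ℕ) : Type := (Fin n → F) × (Fin n → F)

/-- The F-bilinear symplectic form. -/
noncomputable def sB (F : Type) [Field F] (n : ℕ) : LinearMap.BilinForm F (Vv F n) :=
  LinearMap.mk₂ F (fun u v => ∑ i, (v.1 i * u.2 i - u.1 i * v.2 i))
    (by intro a b c; rw [← Finset.sum_add_distrib]; apply Finset.sum_congr rfl; intro i _
        simp only [Prod.fst_add, Prod.snd_add, Pi.add_apply]; ring)
    (by intro a b c; rw [Finset.smul_sum]; apply Finset.sum_congr rfl; intro i _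
        simp only [Prod.smul_fst, Prod.smul_snd, Pi.smul_apply, smul_eq_mul]; ring)
    (by intro a b c; rw [← Finset.sum_add_distrib]; apply Finset.sum_congr rfl; intro i _
        simp only [Prod.fst_add, Prod.snd_add, Pi.add_apply]; ring)
    (by intro a b c; rw [Finset.smul_sum]; apply Finset.sum_congr rfl; intro i _
        simp only [Prod.smul_fst, Prod.smul_snd, Pi.smul_apply, smul_eq_mul]; ring)

lemma sB_apply (u v : Vv F n) : sB F n u v = ∑ i, (v.1 i * u.2 i - u.1 i * v.2 i) := rfl

lemma sB_swap (u v : Vv F n) : sB F n u v = - sB F n v u := by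
  rw [sB_apply, sB_apply, ← Finset.sum_neg_distrib]
  apply Finset.sum_congr rfl; intro i _; ring

lemma sB_self (u : Vv F n) : sB F n u u = 0 := by
  rw [sB_apply]; apply Finset.sum_eq_zero; intro i _; ring

lemma sB_refl : (sB F n).IsRefl := by
  intro x y h; rw [sB_swap, h, neg_zero]

lemma sB_nondeg : (sB F n).Nondegenerate := by
  have hr : LinearMap.IsRefl (sB F n) := fun x y h => sB_refl x y h
  refine (LinearMap.IsRefl.nondegenerate_iff_separatingLeft hr).2 ?_
  intro x hx
  ext i
  · have := hx (0, Pi.single i 1)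
    rw [sB_apply] at this
    simpa [Pi.single_apply] using this
  · have := hx (Pi.single i 1, 0)
    rw [sB_apply] at this
    simpa [Pi.single_apply] using this

/-- Symplectic dual. -/
noncomputable abbrev orth (C : Submodule F (Vv F n)) : Submodule F (Vv F n) := (sB F n).orthogonal C

lemma mem_orth {C : Submodule F (Vv F n)} {x : Vv F n} : x ∈ orth C ↔ ∀ y ∈ C, sB F n x y = 0 := by
  rw [LinearMap.BilinForm.mem_orthogonal_iff]
  constructor
  · intro h y hy; rw [sB_swap, h y hy, neg_zero]
  · intro h y hy; show sB F n y x = 0; rw [sB_swap, h y hy, neg_zero]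

lemma finrank_V : Module.finrank F (Vv F n) = 2 * n := by
  simp [Vv, Module.finrank_prod]; ring

lemma finrank_orth (C : Submodule F (Vv F n)) :
    Module.finrank F (orth C) + Module.finrank F C = 2 * n := by
  have h := LinearMap.BilinForm.finrank_orthogonal sB_nondeg C
  have h2 := Submodule.finrank_le C
  rw [finrank_V] at *
  unfold orth
  omega

lemma orth_orth (C : Submodule F (Vv F n)) : orth (orth C) = C :=
  LinearMap.BilinForm.orthogonal_orthogonal sB_nondeg sB_refl C

lemma orth_anti {C E : Submodule F (Vv F n)} (h : C ≤ E) : orth E ≤ orth C :=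
  LinearMap.BilinForm.orthogonal_le h

lemma sympDual_eq (p : ℕ) (hp : p.Prime) [Fintype F] [CharP F p] (C : Submodule F (Vv F n)) :
    sympDual p (C : Set (Vv F n)) = (orth C : Set (Vv F n)) := by
  ext x
  simp only [SetLike.mem_coe, mem_orth]
  constructor
  · intro h y hy
    by_contra hne
    obtain rfl := ringChar.eq F p
    letI := ZMod.algebra F (ringChar F)
    obtain ⟨b, hb⟩ := FiniteField.trace_to_zmod_nondegenerate F hne
    apply hb
    have := h (b • y) (C.smul_mem b hy)
    unfold trSympForm at this
    rw [← sB_apply, map_smul, smul_eq_mul, mul_comm] at this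
    exact this
  · intro h y hy
    unfold trSympForm
    rw [← sB_apply, h y hy, map_zero]

/-- Vectors supported on `T`. -/
def VT (F : Type) [Field F] {n : ℕ} (T : Finset (Fin n)) : Submodule F (Vv F n) where
  carrier := {v | ∀ i ∉ T, v.1 i = 0 ∧ v.2 i = 0}
  zero_mem' := by intro i _; simp
  add_mem' := by
    intro a b ha hb i hi
    simp [ha i hi, hb i hi]
  smul_mem' := by
    intro c a ha i hi
    simp [ha i hi]

lemma mem_VT {T : Finset (Fin n)} {v : Vv F n} : v ∈ VT F T ↔ ∀ i ∉ T, v.1 i = 0 ∧ v.2 i = 0 :=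
  Iff.rfl

lemma VT_mono {S T : Finset (Fin n)} (h : S ⊆ T) : VT F S ≤ VT F T :=
  fun _ hv i hi => hv i (fun h' => hi (h h'))

lemma finrank_VT (T : Finset (Fin n)) : Module.finrank F (VT F T) = 2 * T.card := by
  classical
  let e : VT F T ≃ₗ[F] ((T → F) × (T → F)) :=
    { toFun := fun v => (fun i => v.1.1 i, fun i => v.1.2 i)
      map_add' := fun _ _ => rfl
      map_smul' := fun _ _ => rfl
      invFun := fun w => ⟨(fun i => if h : i ∈ T then w.1 ⟨i, h⟩ else 0,
          fun i => if h : i ∈ T then w.2 ⟨i, h⟩ else 0), by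
            intro i hi; simp [hi]⟩
      left_inv := by
        rintro ⟨v, hv⟩
        apply Subtype.ext
        ext i
        · by_cases hi : i ∈ T
          · simp [hi]
          · simp [hi, (hv i hi).1]
        · by_cases hi : i ∈ T
          · simp [hi]
          · simp [hi, (hv i hi).2]
      right_inv := by
        intro w
        ext i <;> simp }
  rw [e.finrank_eq]
  simp [Module.finrank_prod]; ring

lemma orth_VT (T : Finset (Fin n)) : orth (VT F T) = VT F Tᶜ := by
  symm
  apply Submodule.eq_of_le_of_finrank_eq
  · intro x hx
    rw [mem_orth]
    intro y hy
    rw [sB_apply]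
    apply Finset.sum_eq_zero
    intro i _
    by_cases hi : i ∈ T
    · have := hx i (by simpa using hi)
      simp [this]
    · have := hy i hi
      simp [this]
  · have := finrank_orth (VT F T)
    rw [finrank_VT] at *
    have h2 := Finset.card_add_card_compl T
    simp only [Fintype.card_fin] at h2
    omega

lemma orth_sup (A B : Submodule F (Vv F n)) : orth (A ⊔ B) = orth A ⊓ orth B := by
  apply le_antisymm
  · exact le_inf (orth_anti le_sup_left) (orth_anti le_sup_right)
  · rintro x ⟨h1, h2⟩
    rw [mem_orth]
    intro y hy
    obtain ⟨a, ha, b, hb, rfl⟩ := Submodule.mem_sup.1 hy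
    rw [map_add, mem_orth.1 h1 a ha, mem_orth.1 h2 b hb, add_zero]

lemma finrank_orth_inf_VT (C : Submodule F (Vv F n)) (T : Finset (Fin n)) :
    Module.finrank F (orth C ⊓ VT F T : Submodule F (Vv F n)) + Module.finrank F C
      = 2 * T.card + Module.finrank F (C ⊓ VT F Tᶜ : Submodule F (Vv F n)) := by
  have h1 : orth C ⊓ VT F T = orth (C ⊔ VT F Tᶜ) := by
    rw [orth_sup, orth_VT, compl_compl]
  rw [h1]
  have h2 := finrank_orth (C ⊔ VT F Tᶜ)
  have h3 := Submodule.finrank_sup_add_finrank_inf_eq C (VT F Tᶜ)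
  rw [finrank_VT] at h3
  have h4 := Finset.card_add_card_compl T
  simp only [Fintype.card_fin] at h4
  omega

lemma swt_le_iff (v : Vv F n) (m : ℕ) (hm : m ≤ n) :
    swt v ≤ m ↔ ∃ T : Finset (Fin n), T.card = m ∧ v ∈ VT F T := by
  classical
  have hs : swt v = (Finset.univ.filter fun i => ¬(v.1 i = 0 ∧ v.2 i = 0)).card := by
    unfold swt
    rw [← Set.ncard_coe_finset]
    congr 1
    ext i; simp
  rw [hs]
  constructor
  · intro h
    obtain ⟨T, hT, hc⟩ := Finset.exists_superset_card_eq h (by simpa using hm)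
    refine ⟨T, hc, ?_⟩
    intro i hi
    by_contra hne
    exact hi (hT (by simpa using hne))
  · rintro ⟨T, rfl, hv⟩
    apply Finset.card_le_card
    intro i hi
    by_contra hne
    simp only [Finset.mem_filter] at hi
    exact hi.2 (hv i hne)

/-- Purity of MDS stabilizer codes. -/
lemma pure_aux (C : Submodule F (Vv F n)) (k d : ℕ) (hk : 0 < k) (hd : 0 < d)
    (hMDS : k + 2 * d = n + 2) (hdim : Module.finrank F C + k = n) (hso : C ≤ orth C)
    (hdist : ∀ v ∈ orth C, v ∉ C → d ≤ swt v) (v : Vv F n) (hv : v ∈ C) (hv0 : v ≠ 0) :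
    d ≤ swt v := by
  classical
  have key : ∀ T : Finset (Fin n), T.card = d - 1 →
      Module.finrank F (C ⊓ VT F T : Submodule F (Vv F n))
        = Module.finrank F (C ⊓ VT F Tᶜ : Submodule F (Vv F n)) := by
    intro T hT
    have h1 : orth C ⊓ VT F T = C ⊓ VT F T := by
      apply le_antisymm
      · rintro x ⟨hx1, hx2⟩
        refine ⟨?_, hx2⟩
        by_contra hx
        have h2 := hdist x hx1 hx
        have h3 := (swt_le_iff x (d - 1) (by omega)).2 ⟨T, hT, hx2⟩
        omega
      · exact inf_le_inf_right _ hso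
    have h2 := finrank_orth_inf_VT C T
    rw [h1] at h2
    omega
  have key2 : ∀ T T' : Finset (Fin n), T.card = d - 1 → T'.card = d - 1 → T' ⊆ Tᶜ →
      C ⊓ VT F T' = C ⊓ VT F Tᶜ := by
    intro T T' hT hT' hsub
    apply Submodule.eq_of_le_of_finrank_le
    · exact inf_le_inf_left _ (VT_mono hsub)
    · rw [← key T hT, key T' hT']
      apply Submodule.finrank_mono
      apply inf_le_inf_left
      apply VT_mono
      intro i hi
      rw [Finset.mem_compl]
      intro h'
      exact (Finset.mem_compl.1 (hsub h')) hi
  by_contra hlt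
  obtain ⟨T, hT, hvT⟩ := (swt_le_iff v (d - 1) (by omega)).1 (by omega)
  have hcard := Finset.card_add_card_compl T
  simp only [Fintype.card_fin] at hcard
  have hz : C ⊓ VT F Tᶜ = ⊥ := by
    rw [eq_bot_iff]
    intro x hx
    have hx0 : ∀ i, x.1 i = 0 ∧ x.2 i = 0 := by
      intro i
      by_cases hi : i ∈ T
      · exact hx.2 i (by simpa using hi)
      · obtain ⟨T', hT', hc'⟩ := Finset.exists_subset_card_eq (s := Tᶜ.erase i) (n := d - 1)
          (by rw [Finset.card_erase_of_mem (by simpa using hi)]; omega)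
        have hx' := hx
        rw [← key2 T T' hT hc' (hT'.trans (Finset.erase_subset _ _))] at hx'
        exact hx'.2 i (fun h' => by simpa using hT' h')
    rw [Submodule.mem_bot]
    ext i
    · exact (hx0 i).1
    · exact (hx0 i).2
  have h0 := key T hT
  rw [hz, finrank_bot, Submodule.finrank_eq_zero] at h0
  apply hv0
  rw [← Submodule.mem_bot F, ← h0]
  exact ⟨hv, hvT⟩

/-- Weight-`d` words generate an MDS code. -/
lemma exists_low (E C : Submodule F (Vv F n)) (d : ℕ) (hd : 0 < d) (hdn : d ≤ n)
    (hdim : Module.finrank F E + 2 * d = 2 * n + 2) (hmin : ∀ v ∈ E, v ≠ 0 → d ≤ swt v)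
    (hCE : C ≤ E) (hne : C ≠ E) : ∃ v ∈ E, v ∉ C ∧ swt v ≤ d := by
  classical
  by_contra hcon
  push Not at hcon
  apply hne
  apply le_antisymm hCE
  obtain ⟨T, -, hT⟩ := Finset.exists_subset_card_eq (s := (Finset.univ : Finset (Fin n)))
    (n := d - 1) (by simp; omega)
  have hET : E ⊓ VT F T = ⊥ := by
    rw [eq_bot_iff]
    rintro x ⟨hx1, hx2⟩
    rw [Submodule.mem_bot]
    by_contra hx
    have h2 := hmin x hx1 hx
    have h3 := (swt_le_iff x (d - 1) (by omega)).2 ⟨T, hT, hx2⟩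
    omega
  have hsup : E ⊔ VT F T = ⊤ := by
    apply Submodule.eq_top_of_finrank_eq
    have h3 := Submodule.finrank_sup_add_finrank_inf_eq E (VT F T)
    rw [hET, finrank_bot, finrank_VT] at h3
    rw [finrank_V]
    omega
  have hsingle : ∀ i : Fin n, VT F {i} ≤ C ⊔ VT F T := by
    intro i x hx
    by_cases hi : i ∈ T
    · exact Submodule.mem_sup_right (VT_mono (by simpa using hi) hx)
    have hx' : x ∈ E ⊔ VT F T := by rw [hsup]; trivial
    obtain ⟨w, hw, t, ht, rfl⟩ := Submodule.mem_sup.1 hx'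
    refine Submodule.add_mem_sup ?_ ht
    by_contra hwC
    have h1 := hcon w hw hwC
    have h2 : swt w ≤ d := by
      refine (swt_le_iff w d hdn).2 ⟨insert i T, by rw [Finset.card_insert_of_notMem hi]; omega, ?_⟩
      have : w = (w + t) - t := by simp
      rw [this]
      exact Submodule.sub_mem _ (VT_mono (by simp) hx) (VT_mono (by simp) ht)
    omega
  intro e he
  have hall : e ∈ C ⊔ VT F T := by
    have : e = ∑ i, ((Pi.single i (e.1 i), Pi.single i (e.2 i)) : Vv F n) := by
      ext j
      · rw [Prod.fst_sum, Finset.sum_apply]; simp [Pi.single_apply]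
      · rw [Prod.snd_sum, Finset.sum_apply]; simp [Pi.single_apply]
    rw [this]
    refine Submodule.sum_mem _ (fun i _ => hsingle i ?_)
    intro j hj
    have : j ≠ i := by simpa using hj
    simp [Pi.single_apply, this]
  obtain ⟨c, hc, t, ht, rfl⟩ := Submodule.mem_sup.1 hall
  have : t ∈ E ⊓ VT F T := ⟨by simpa using E.sub_mem he (hCE hc), ht⟩
  rw [hET, Submodule.mem_bot] at this
  simpa [this] using hc

/-- Gauge extension. -/
lemma exists_gauge (C0 : Submodule F (Vv F n)) (k : ℕ) (hdim : Module.finrank F C0 + k = n)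
    (hso : C0 ≤ orth C0) (r : ℕ) (hr : r ≤ k) : ∃ C : Submodule F (Vv F n),
      C ≤ orth C0 ∧ C ⊓ orth C = C0 ∧ Module.finrank F C = Module.finrank F C0 + 2 * r := by
  induction r with
  | zero => exact ⟨C0, hso, inf_eq_left.2 hso, by simp⟩
  | succ r ih =>
    obtain ⟨C, hCE, hCC, hCd⟩ := ih (by omega)
    have hC0 : C0 ≤ C := hCC ▸ inf_le_left
    have hfo := finrank_orth C
    have hlt : ¬ orth C ≤ C0 := by
      intro h
      have := Submodule.finrank_mono h
      omega
    obtain ⟨u, hu, hu0⟩ := SetLike.not_le_iff_exists.1 hlt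
    have hv : ∃ v ∈ orth C, sB F n u v ≠ 0 := by
      by_contra hcon
      push Not at hcon
      apply hu0
      rw [← hCC]
      exact ⟨by rw [← orth_orth C]; exact mem_orth.2 hcon, hu⟩
    obtain ⟨v, hv, huv⟩ := hv
    have hvu : sB F n v u ≠ 0 := by rw [sB_swap]; exact neg_ne_zero.2 huv
    have hanti := orth_anti hC0
    have hdec : ∀ x ∈ C, ∀ a b : F, sB F n (x + (a • u + b • v)) u = 0 →
        sB F n (x + (a • u + b • v)) v = 0 → a = 0 ∧ b = 0 := by
      intro x hx a b h1 h2
      have e1 : sB F n x u = 0 := by rw [sB_swap, mem_orth.1 hu x hx, neg_zero]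
      have e2 : sB F n x v = 0 := by rw [sB_swap, mem_orth.1 hv x hx, neg_zero]
      simp only [map_add, map_smul, LinearMap.add_apply, LinearMap.smul_apply, sB_self, e1, e2,
        smul_eq_mul, mul_zero, zero_add, add_zero] at h1 h2
      exact ⟨(mul_eq_zero.1 h2).resolve_right huv, (mul_eq_zero.1 h1).resolve_right hvu⟩
    have huS : u ∈ C ⊔ Submodule.span F {u, v} :=
      Submodule.mem_sup_right (Submodule.subset_span (by simp))
    have hvS : v ∈ C ⊔ Submodule.span F {u, v} :=
      Submodule.mem_sup_right (Submodule.subset_span (by simp))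
    have hE : C ⊔ Submodule.span F {u, v} ≤ orth C0 := by
      refine sup_le hCE (Submodule.span_le.2 ?_)
      rintro x (rfl | rfl)
      · exact hanti hu
      · exact hanti hv
    refine ⟨C ⊔ Submodule.span F {u, v}, hE, ?_, ?_⟩
    · apply le_antisymm
      · rintro x ⟨hx1, hx2⟩
        obtain ⟨c, hc, s, hs, rfl⟩ := Submodule.mem_sup.1 hx1
        obtain ⟨a, b, rfl⟩ := Submodule.mem_span_pair.1 hs
        obtain ⟨rfl, rfl⟩ := hdec c hc a b (mem_orth.1 hx2 u huS) (mem_orth.1 hx2 v hvS)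
        rw [← hCC]
        have h3 := orth_anti (le_sup_left : C ≤ C ⊔ Submodule.span F {u, v}) hx2
        simp only [zero_smul, add_zero] at h3 ⊢
        exact ⟨hc, h3⟩
      · refine le_inf (hC0.trans le_sup_left) ?_
        have := orth_anti hE
        rwa [orth_orth] at this
    · have hinf : C ⊓ Submodule.span F {u, v} = ⊥ := by
        rw [eq_bot_iff]
        rintro x ⟨hx1, hx2⟩
        obtain ⟨a, b, rfl⟩ := Submodule.mem_span_pair.1 hx2
        have e1 : sB F n (a • u + b • v) u = 0 := by
          rw [sB_swap, mem_orth.1 hu _ hx1, neg_zero]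
        have e2 : sB F n (a • u + b • v) v = 0 := by
          rw [sB_swap, mem_orth.1 hv _ hx1, neg_zero]
        obtain ⟨rfl, rfl⟩ := hdec 0 C.zero_mem a b (by rwa [zero_add]) (by rwa [zero_add])
        simp
      have hsp : Module.finrank F (Submodule.span F {u, v}) = 2 := by
        have hli : LinearIndependent F ![u, v] := by
          rw [LinearIndependent.pair_iff]
          intro a b hab
          exact hdec 0 C.zero_mem a b (by rw [zero_add, hab]; simp) (by rw [zero_add, hab]; simp)
        have := finrank_span_eq_card hli
        rw [Matrix.range_cons_cons_empty] at this
        simpa using this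
      have h3 := Submodule.finrank_sup_add_finrank_inf_eq C (Submodule.span F {u, v})
      rw [hinf, finrank_bot, hsp] at h3
      omega

lemma card_sub [Fintype F] (C : Submodule F (Vv F n)) :
    Nat.card C = Fintype.card F ^ Module.finrank F C := by
  rw [Module.natCard_eq_pow_finrank (K := F), Nat.card_eq_fintype_card]

lemma minSwt_eq {S : Set (Vv F n)} {d : ℕ} (h1 : ∀ v ∈ S, v ≠ 0 → d ≤ swt v)
    (h2 : ∃ v ∈ S, v ≠ 0 ∧ swt v ≤ d) : d = minSwt S := by
  obtain ⟨v, hv, hv0, hvd⟩ := h2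
  apply le_antisymm
  · apply le_csInf
    · exact ⟨_, v, ⟨hv, hv0⟩, rfl⟩
    · rintro _ ⟨w, ⟨hw, hw0⟩, rfl⟩
      exact h1 w hw hw0
  · exact (show minSwt S ≤ swt v from Nat.sInf_le ⟨v, ⟨hv, hv0⟩, rfl⟩).trans hvd

lemma minSwt_le {S : Set (Vv F n)} {v : Vv F n} (hv : v ∈ S) (hv0 : v ≠ 0) : minSwt S ≤ swt v :=
  Nat.sInf_le ⟨v, ⟨hv, hv0⟩, rfl⟩

end MDSAux

open MDSAux

/-- MDS subsystem codes from MDS stabilizer codes.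
If there exists an `F_q`-linear `[[n,k,d]]_q` MDS stabilizer code (i.e. with
`k = n − 2d + 2`), then for every `0 ≤ r ≤ k` there exists a pure `F_q`-linear
`[[n, k−r, r, d]]_q` MDS Clifford subsystem code, i.e. one whose parameters
satisfy `(k−r) + r = n − 2d + 2` and whose minimum distance is exactly `d`. -/
theorem mds_subsystem_codes_from_mds_stabilizer_codes
    (p : ℕ) (hp : p.Prime) (F : Type) [Field F] [Fintype F] [CharP F p]
    (n k d : ℕ) (hMDS : k + 2 * d = n + 2)
    (h : ∃ C : AddSubgroup ((Fin n → F) × (Fin n → F)),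
      IsSubsysCode p C (Fintype.card F ^ k) 1 d ∧ FqLinear C) :
    ∀ r : ℕ, r ≤ k →
      ∃ C : AddSubgroup ((Fin n → F) × (Fin n → F)),
        IsSubsysCode p C (Fintype.card F ^ (k - r)) (Fintype.card F ^ r) d ∧
        FqLinear C ∧ PureTo C d ∧ (k - r) + r + 2 * d = n + 2 := by
  classical
  obtain ⟨A, ⟨hc1, hc2, hd1, hd2⟩, hlin⟩ := h
  intro r hr
  have hq : 1 < Fintype.card F := Fintype.one_lt_card
  -- the code as a submodule
  let C0 : Submodule F (Vv F n) :=
    { A with smul_mem' := fun a v hv => hlin a v hv }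
  have hA : (A : Set (Vv F n)) = (C0 : Set (Vv F n)) := rfl
  have hcardA : Nat.card A = Nat.card C0 := rfl
  rw [hA, sympDual_eq p hp C0] at hc1 hd1 hd2
  rw [← Submodule.coe_inf] at hc1 hd1 hd2
  have hc1' : Nat.card (C0 ⊓ orth C0 : Submodule F (Vv F n)) * (Fintype.card F ^ k * 1)
    = Fintype.card F ^ n := hc1
  rw [hcardA] at hc2
  rw [card_sub, mul_one, ← pow_add] at hc1'
  rw [card_sub, mul_one, ← pow_add] at hc2
  have e1 := Nat.pow_right_injective hq hc1'
  have hdim : Module.finrank F C0 + k = n := Nat.pow_right_injective hq hc2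
  have hinf : C0 ⊓ orth C0 = C0 :=
    Submodule.eq_of_le_of_finrank_eq inf_le_left (by omega)
  have hso : C0 ≤ orth C0 := inf_eq_left.1 hinf
  rw [hinf, sympDual_eq p hp C0] at hd1 hd2
  have hd : 0 < d := by omega
  have hfo := finrank_orth C0
  have hmin : (∀ v ∈ orth C0, v ≠ 0 → d ≤ swt v) := by
    by_cases hE : orth C0 = C0
    · have := hd1 (by rw [hE])
      intro v hv hv0
      rw [this]
      exact minSwt_le hv hv0
    · have h3 := hd2 (fun h' => hE (SetLike.coe_injective h'))
      have hdist : ∀ v ∈ orth C0, v ∉ C0 → d ≤ swt v := by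
        intro v hv hvC
        rw [h3]
        exact minSwt_le ⟨hv, hvC⟩ (fun h0 => hvC (h0 ▸ C0.zero_mem))
      have hk : 0 < k := by
        by_contra hk
        exact hE (Submodule.eq_of_le_of_finrank_eq hso (by omega)).symm
      intro v hv hv0
      by_cases hvC : v ∈ C0
      · exact pure_aux C0 k d hk hd hMDS hdim hso hdist v hvC hv0
      · exact hdist v hv hvC
  have hdn : d ≤ n := by
    rcases Nat.lt_or_ge n d with hlt | hge
    · exfalso
      -- then n = 0 or so; use attainment
      have hn : n = 0 := by omega
      subst hn
      have hsub : ∀ S : Set (Vv F 0), minSwt S = 0 := by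
        intro S
        have : S \ {0} = ∅ := by
          rw [Set.eq_empty_iff_forall_notMem]
          intro x hx; exact hx.2 (Subsingleton.elim _ _)
        unfold minSwt
        rw [this]; simp
      by_cases hE : (orth C0 : Set (Vv F 0)) = C0
      · have := hd1 hE; rw [hsub] at this; omega
      · have := hd2 hE; rw [hsub] at this; omega
    · exact hge
  obtain ⟨C, hCE, hCC, hCd⟩ := exists_gauge C0 k hdim hso r hr
  have hlow : ∀ B : Submodule F (Vv F n), B ≤ orth C0 → B ≠ orth C0 →
      ∃ v ∈ orth C0, v ∉ B ∧ swt v ≤ d := fun B h1 h2 =>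
    exists_low (orth C0) B d hd hdn (by omega) hmin h1 h2
  have hCs : ((C.toAddSubgroup : AddSubgroup (Vv F n)) : Set (Vv F n)) = (C : Set (Vv F n)) := rfl
  refine ⟨C.toAddSubgroup, ⟨?_, ?_, ?_, ?_⟩, ?_, ?_, by omega⟩
  · rw [hCs, sympDual_eq p hp C, ← Submodule.coe_inf, hCC]
    change Nat.card C0 * _ = _
    rw [card_sub, ← pow_add, ← pow_add]
    congr 1; omega
  · change Nat.card C * _ = _
    rw [card_sub, ← pow_add, ← pow_add]
    congr 1; omega
  · rw [hCs, sympDual_eq p hp C, ← Submodule.coe_inf, hCC, sympDual_eq p hp C0]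
    intro _
    refine minSwt_eq hmin ?_
    obtain ⟨v, hv, hv0, hvd⟩ := hlow ⊥ bot_le (by
      intro h0
      rw [← h0, finrank_bot] at hfo
      omega)
    exact ⟨v, hv, by simpa using hv0, hvd⟩
  · rw [hCs, sympDual_eq p hp C, ← Submodule.coe_inf, hCC, sympDual_eq p hp C0]
    intro hne
    refine minSwt_eq (fun v hv => hmin v hv.1) ?_
    obtain ⟨v, hv, hv0, hvd⟩ := hlow C hCE (fun h' => hne (by rw [h']))
    exact ⟨v, ⟨hv, hv0⟩, fun h0 => hv0 (h0 ▸ C.zero_mem), hvd⟩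
  · intro a v hv
    exact C.smul_mem a hv
  · intro v hv hv0
    exact hmin v (hCE hv) hv0
end

section
/- A family of MDS subsystem codes from Reed-Solomon codes: For every prime power q and all integers δ and r with 0 ≤ δ < q − 1 and 0 ≤ r < q^2 − 2δ − 1, there exists a pure F_q-linear MDS Clifford subsystem code with parameters [[q^2 − 1, q^2 − 2δ − 1 − r, r, δ + 1]]_q. -/
open Finset

theorem symp_ext {F V : Type*} [Field F] [AddCommGroup V] [Module F V] [FiniteDimensional F V]
    (B : LinearMap.BilinForm F V) (hB : B.Nondegenerate) (hA : B.IsAlt)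
    (D : Submodule F V) (hD : D ≤ B.orthogonal D) (r : ℕ)
    (hr : 2 * r + 2 * Module.finrank F D ≤ Module.finrank F V) :
    ∃ C : Submodule F V, D ≤ C ∧ C ≤ B.orthogonal D ∧ C ⊓ B.orthogonal C = D ∧
      Module.finrank F C = Module.finrank F D + 2 * r := by
  have hR : B.IsRefl := hA.isRefl
  induction r with
  | zero => exact ⟨D, le_rfl, hD, inf_eq_left.2 hD, rfl⟩
  | succ r ih =>
    obtain ⟨C, h1, h2, h3, h4⟩ := ih (by omega)
    have hf := LinearMap.BilinForm.finrank_orthogonal hB C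
    have : ¬ B.orthogonal C ≤ D := fun h => by
      have := Submodule.finrank_mono h
      omega
    obtain ⟨v, hv, hvD⟩ := Set.not_subset.1 this
    simp only [SetLike.mem_coe] at hv hvD
    have hvC : v ∉ C := fun h => hvD (h3 ▸ ⟨h, hv⟩)
    have : ∃ w ∈ B.orthogonal C, B w v ≠ 0 := by
      by_contra! h
      apply hvC
      rw [← LinearMap.BilinForm.orthogonal_orthogonal hB hR C,
        LinearMap.BilinForm.mem_orthogonal_iff]
      exact fun w hw => h w hw
    obtain ⟨w, hw, hwv⟩ := this
    have hv' : ∀ c ∈ C, B c v = 0 := fun c hc => hv c hc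
    have hw' : ∀ c ∈ C, B c w = 0 := fun c hc => hw c hc
    have hvv : B v v = 0 := hA v
    have hww : B w w = 0 := hA w
    have hvw : B v w = - B w v := (hA.neg_eq w v).symm
    have hsup : ∀ x, x ∈ C ⊔ Submodule.span F {v, w} ↔
        ∃ c ∈ C, ∃ a b : F, x = c + a • v + b • w := by
      intro x
      simp only [Submodule.mem_sup, Submodule.mem_span_pair]
      constructor
      · rintro ⟨c, hc, _, ⟨a, b, rfl⟩, rfl⟩
        exact ⟨c, hc, a, b, by abel⟩
      · rintro ⟨c, hc, a, b, rfl⟩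
        exact ⟨c, hc, _, ⟨a, b, rfl⟩, by abel⟩
    have key : ∀ c ∈ C, ∀ a b : F, B (c + a • v + b • w) v = 0 →
        B (c + a • v + b • w) w = 0 → a = 0 ∧ b = 0 := by
      intro c hc a b e1 e2
      simp [hv' c hc, hw' c hc, hvv, hww, hvw, hwv] at e1 e2
      exact ⟨e2, e1⟩
    refine ⟨C ⊔ Submodule.span F {v, w}, h1.trans le_sup_left, ?_, ?_, ?_⟩
    · refine sup_le h2 ?_
      have := LinearMap.BilinForm.orthogonal_le (B := B) h1
      rw [Submodule.span_le]
      rintro x (rfl | rfl)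
      exacts [this hv, this hw]
    · apply le_antisymm
      · rintro x ⟨hx, hx2⟩
        obtain ⟨c, hc, a, b, rfl⟩ := (hsup _).1 hx
        have hx2' : ∀ y ∈ C ⊔ Submodule.span F {v, w}, B y (c + a • v + b • w) = 0 := 
          fun y hy => hx2 y hy
        obtain ⟨rfl, rfl⟩ := key c hc a b
          (hR _ _ (hx2' v (Submodule.mem_sup_right (Submodule.subset_span (by simp)))))
          (hR _ _ (hx2' w (Submodule.mem_sup_right (Submodule.subset_span (by simp)))))
        rw [← h3]
        refine ⟨by simpa using hc, fun y hy => hx2' y (Submodule.mem_sup_left hy)⟩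
      · intro d hd
        refine ⟨Submodule.mem_sup_left (h1 hd), ?_⟩
        change d ∈ B.orthogonal _
        rw [LinearMap.BilinForm.mem_orthogonal_iff]
        intro x hx
        obtain ⟨c, hc, a, b, rfl⟩ := (hsup _).1 hx
        have e1 : B c d = 0 := hR _ _ (h2 hc d hd)
        have e2 : B v d = 0 := hR _ _ (hv' d (h1 hd))
        have e3 : B w d = 0 := hR _ _ (hw' d (h1 hd))
        simp [e1, e2, e3]
    · have hli : LinearIndependent F ![v, w] := by
        rw [LinearIndependent.pair_iff]
        intro a b hab
        apply key 0 C.zero_mem a b <;> simp only [zero_add, hab, map_zero, LinearMap.zero_apply]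
      have hfr := finrank_span_eq_card hli
      have hrange : Set.range ![v, w] = {v, w} := by simp [Set.pair_comm]
      rw [hrange] at hfr
      have hdis : C ⊓ Submodule.span F {v, w} = ⊥ := by
        rw [eq_bot_iff]
        rintro x ⟨hx, hx2⟩
        obtain ⟨a, b, rfl⟩ := Submodule.mem_span_pair.1 hx2
        obtain ⟨rfl, rfl⟩ := key 0 C.zero_mem a b (by simpa using hv' _ hx)
          (by simpa using hw' _ hx)
        simp
      have := Submodule.finrank_sup_add_finrank_inf_eq C (Submodule.span F {v, w})
      rw [hdis, finrank_bot, hfr] at this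
      simp at this
      omega

open Polynomial in
theorem rs_selforth {K : Type*} [Field K] [Fintype K] (q δ n : ℕ) (hc : Fintype.card K = q ^ 2)
    (hδ : δ + 1 < q) (e : Fin n ≃ Kˣ) (g h : K[X]) (hg : g.degree < δ) (hh : h.degree < δ) :
    ∑ i, ((e i : K) * g.eval (e i : K)) * ((e i : K) * h.eval (e i : K)) ^ q = 0 := by
  classical
  set f : K[X] := (X * g) * (X * h) ^ q with hf
  have h1 : ∀ x : K, (x * g.eval x) * (x * h.eval x) ^ q = f.eval x := by
    intro x; simp [hf]
  simp_rw [h1]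
  rw [Equiv.sum_comp e (fun x : Kˣ => f.eval (x : K))]
  have hq : 0 < q := by omega
  have h0 : f.eval 0 = 0 := by simp [hf]
  have hdeg : f.natDegree < Fintype.card K - 1 := by
    by_cases hg0 : g = 0
    · simp only [hf, hg0, mul_zero, zero_mul, natDegree_zero, hc]
      have : 2 ^ 2 ≤ q ^ 2 := Nat.pow_le_pow_left (by omega) 2
      omega
    by_cases hh0 : h = 0
    · simp only [hf, hh0, mul_zero, zero_pow hq.ne', natDegree_zero, hc]
      have : 2 ^ 2 ≤ q ^ 2 := Nat.pow_le_pow_left (by omega) 2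
      omega
    have hg' := (natDegree_lt_iff_degree_lt hg0).2 hg
    have hh' := (natDegree_lt_iff_degree_lt hh0).2 hh
    have : f.natDegree ≤ δ + q * δ := by
      refine natDegree_mul_le.trans (add_le_add ?_ (natDegree_pow_le.trans ?_))
      · refine natDegree_mul_le.trans ?_
        simp; omega
      · refine Nat.mul_le_mul_left q (natDegree_mul_le.trans ?_)
        simp; omega
    rw [hc]
    obtain ⟨m, rfl⟩ : ∃ m, q = δ + 2 + m := ⟨q - δ - 2, by omega⟩
    have : δ + (δ + 2 + m) * δ + 2 ≤ (δ + 2 + m) ^ 2 := by nlinarith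
    omega
  have hs : ∑ x : K, f.eval x = 0 := by
    simp_rw [eval_eq_sum_range]
    rw [Finset.sum_comm]
    refine Finset.sum_eq_zero fun i hi => ?_
    rw [← Finset.mul_sum, FiniteField.sum_pow_lt_card_sub_one, mul_zero]
    simp at hi; omega
  rw [← hs, ← Finset.add_sum_erase _ _ (Finset.mem_univ (0 : K)), h0, zero_add]
  refine Finset.sum_bij (fun x _ => (x : K)) (by simp) (by simp [Units.ext_iff]) ?_ (by simp)
  intro b hb
  exact ⟨Units.mk0 b (by simpa using hb), by simp, by simp⟩

open Polynomial in
theorem rs_dist {K : Type*} [Field K] (δ n : ℕ) (σ : K →+* K) (e : Fin n → Kˣ)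
    (he : Function.Injective e) (x : Fin n → K) (hx : x ≠ 0)
    (h : ∀ g : K[X], g.degree < δ → ∑ i, x i * σ ((e i : K) * g.eval (e i : K)) = 0) :
    δ + 1 ≤ {i | x i ≠ 0}.ncard := by
  classical
  by_contra hlt
  obtain ⟨j, hj⟩ := Function.ne_iff.1 hx
  simp only [Pi.zero_apply] at hj
  set S : Finset (Fin n) := univ.filter (fun i => x i ≠ 0) with hS
  have hSc : {i | x i ≠ 0}.ncard = #S := by
    rw [← Set.ncard_coe_finset]; congr 1; ext; simp [hS]
  have hjS : j ∈ S := by simp [hS, hj]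
  have := h (∏ i ∈ S.erase j, (X - C (e i : K))) (by
    rw [degree_prod]
    simp only [degree_X_sub_C, sum_const, card_erase_of_mem hjS]
    have : #S - 1 < δ := by have := Finset.card_pos.2 ⟨j, hjS⟩; omega
    simpa using this)
  rw [Finset.sum_eq_single j] at this
  · simp [hj, eval_prod, prod_eq_zero_iff, sub_eq_zero] at this
    obtain ⟨a, ⟨ha, _⟩, h2⟩ := this
    exact ha (he (Units.ext (σ.injective h2))).symm
  · intro b _ hb
    by_cases hb0 : x b = 0
    · simp [hb0]
    · have : b ∈ S.erase j := by simp [hS, hb, hb0]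
      rw [eval_prod, Finset.prod_eq_zero this (by simp)]
      simp
  · simp

open Polynomial in
theorem rs_min {K : Type*} [Field K] (δ n : ℕ) (σ : K →+* K) (e : Fin n → Kˣ)
    (he : Function.Injective e) (A : Finset (Fin n)) (hA : #A = δ + 1) (j : Fin n) (hj : j ∈ A)
    (c : K) :
    ∃ z : Fin n → K, z j = c ∧ (∀ i ∉ A, z i = 0) ∧
    (∀ g : K[X], g.degree < δ → ∑ i, z i * σ ((e i : K) * g.eval (e i : K)) = 0) := by
  classical
  let u : Fin n → K := fun i => ((e i : K) * ∏ k ∈ A.erase i, ((e i : K) - e k))⁻¹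
  have hu : u j ≠ 0 := by
    simp only [u]
    apply inv_ne_zero
    apply mul_ne_zero (e j).ne_zero
    rw [Finset.prod_ne_zero_iff]
    intro k hk
    rw [sub_ne_zero]
    intro h
    exact (Finset.ne_of_mem_erase hk) (he (Units.ext h)).symm
  refine ⟨fun i => if i ∈ A then (c / σ (u j)) * σ (u i) else 0, ?_, ?_, ?_⟩
  · have : σ (u j) ≠ 0 := by simpa using hu
    simp [hj, this]
  · intro i hi; simp [hi]
  · intro g hg
    have hinj : Set.InjOn (fun i => (e i : K)) A := fun a _ b _ h => he (Units.ext h)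
    have h1 := Lagrange.coeff_eq_sum hinj (P := g) (by
      rw [hA]; exact hg.trans (by exact_mod_cast Nat.lt_succ_self δ))
    rw [hA, Nat.add_sub_cancel, coeff_eq_zero_of_degree_lt hg] at h1
    simp only [ite_mul, zero_mul, Finset.sum_ite_mem, Finset.univ_inter]
    simp_rw [mul_assoc, ← map_mul]
    rw [← Finset.mul_sum, ← map_sum]
    have : ∑ i ∈ A, u i * ((e i : K) * g.eval (e i : K)) = 0 := by
      rw [h1]
      refine Finset.sum_congr rfl fun i hi => ?_
      have := (e i).ne_zero
      simp only [u, mul_inv, div_eq_mul_inv]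
      rw [mul_comm, mul_mul_mul_comm, mul_inv_cancel₀ this, one_mul]
    rw [this]; simp

/-- The `F`-valued symplectic form. -/
noncomputable def sympB (F : Type) [Field F] (n : ℕ) :
    LinearMap.BilinForm F ((Fin n → F) × (Fin n → F)) :=
  LinearMap.mk₂ F (fun u v => ∑ i, (v.1 i * u.2 i - u.1 i * v.2 i))
    (fun a b c => by
      rw [← Finset.sum_add_distrib]; refine Finset.sum_congr rfl fun i _ => ?_
      simp only [Prod.fst_add, Prod.snd_add, Pi.add_apply]; ring)
    (fun a b c => by
      rw [Finset.smul_sum]; refine Finset.sum_congr rfl fun i _ => ?_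
      simp only [Prod.smul_fst, Prod.smul_snd, Pi.smul_apply, smul_eq_mul]; ring)
    (fun a b c => by
      rw [← Finset.sum_add_distrib]; refine Finset.sum_congr rfl fun i _ => ?_
      simp only [Prod.fst_add, Prod.snd_add, Pi.add_apply]; ring)
    (fun a b c => by
      rw [Finset.smul_sum]; refine Finset.sum_congr rfl fun i _ => ?_
      simp only [Prod.smul_fst, Prod.smul_snd, Pi.smul_apply, smul_eq_mul]; ring)

theorem sympB_apply {F : Type} [Field F] {n : ℕ} (u v : (Fin n → F) × (Fin n → F)) :
    sympB F n u v = ∑ i, (v.1 i * u.2 i - u.1 i * v.2 i) := rfl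

theorem sympB_isAlt (F : Type) [Field F] (n : ℕ) : (sympB F n).IsAlt := by
  intro u
  rw [sympB_apply]
  exact Finset.sum_eq_zero fun i _ => by ring

theorem sympB_nondeg (F : Type) [Field F] (n : ℕ) : (sympB F n).Nondegenerate := by
  classical
  have hR : LinearMap.IsRefl (sympB F n) := (sympB_isAlt F n).isRefl
  refine (LinearMap.IsRefl.nondegenerate_iff_separatingLeft hR).2 ?_
  intro u hu
  apply Prod.ext
  · funext i
    have := hu (0, Pi.single i 1)
    rw [sympB_apply] at this
    simpa [Pi.single_apply] using this
  · funext i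
    have := hu (Pi.single i 1, 0)
    rw [sympB_apply] at this
    simpa [Pi.single_apply] using this

theorem trSympForm_eq (p : ℕ) {F : Type} [Field F] [Fintype F] [CharP F p] {n : ℕ}
    (u v : (Fin n → F) × (Fin n → F)) :
    trSympForm p u v = letI := ZMod.algebra F p
      Algebra.trace (ZMod p) F (sympB F n u v) := rfl

theorem exists_trace_ne (p : ℕ) (hp : p.Prime) {F : Type} [Field F] [Fintype F] [CharP F p]
    {a : F} (ha : a ≠ 0) : ∃ b : F, (letI := ZMod.algebra F p
      Algebra.trace (ZMod p) F (b * a)) ≠ 0 := by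
  letI := ZMod.algebra F p
  obtain rfl := ringChar.eq F p
  obtain ⟨b, hb⟩ := FiniteField.trace_to_zmod_nondegenerate F ha
  exact ⟨b, by rwa [mul_comm]⟩

theorem sympDual_eq (p : ℕ) (hp : p.Prime) {F : Type} [Field F] [Fintype F] [CharP F p] {n : ℕ}
    (C : Submodule F ((Fin n → F) × (Fin n → F))) :
    sympDual p (C : Set ((Fin n → F) × (Fin n → F))) = (sympB F n).orthogonal C := by
  have hR : (sympB F n).IsRefl := (sympB_isAlt F n).isRefl
  ext v
  constructor
  · intro hv w hw
    apply hR
    by_contra hne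
    obtain ⟨b, hb⟩ := exists_trace_ne p hp hne
    apply hb
    have := hv (b • w) (C.smul_mem b hw)
    rw [trSympForm_eq] at this
    simpa using this
  · intro hv w hw
    have : sympB F n v w = 0 := hR _ _ (hv w hw)
    rw [trSympForm_eq, this]
    simp

theorem swt_eq {F K : Type} [Field F] [Field K] [Algebra F K] {n : ℕ}
    (ψ : ((Fin n → F) × (Fin n → F)) → (Fin n → K))
    (h : ∀ v i, ψ v i = 0 ↔ (v.1 i = 0 ∧ v.2 i = 0)) (v) : swt v = {i | ψ v i ≠ 0}.ncard := by
  unfold swt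
  congr 1
  ext i
  simp [h]

theorem exists_quad (p : ℕ) (hp : p.Prime) (F : Type) [Field F] [Fintype F] [CharP F p] :
    ∃ (K : Type) (_ : Field K) (_ : Fintype K) (_ : Algebra F K),
      Fintype.card K = Fintype.card F ^ 2 ∧ Module.finrank F K = 2 := by
  haveI : Fact p.Prime := ⟨hp⟩
  haveI : Finite (FiniteField.Extension F p 2) := by
    have := FiniteField.natCard_extension F p 2
    apply Nat.finite_of_card_ne_zero
    rw [this]
    have : 0 < Nat.card F := Nat.card_pos
    positivity
  refine ⟨FiniteField.Extension F p 2, inferInstance, Fintype.ofFinite _, inferInstance, ?_,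
    FiniteField.finrank_extension F p 2⟩
  have h := FiniteField.natCard_extension F p 2
  letI := Fintype.ofFinite (FiniteField.Extension F p 2)
  rw [Nat.card_eq_fintype_card, Nat.card_eq_fintype_card] at h
  exact h

/-- Identification of `F^{2n}` with `K^n`. -/
noncomputable def psiMap {F K : Type} [Field F] [Field K] [Algebra F K] (n : ℕ) (θ : K) :
    ((Fin n → F) × (Fin n → F)) →ₗ[F] (Fin n → K) where
  toFun v i := algebraMap F K (v.1 i) + algebraMap F K (v.2 i) * θ
  map_add' u v := by
    funext i
    simp only [Prod.fst_add, Prod.snd_add, Pi.add_apply, map_add]; ring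
  map_smul' a v := by
    funext i
    simp only [Prod.smul_fst, Prod.smul_snd, Pi.smul_apply, smul_eq_mul, map_mul,
      RingHom.id_apply]
    rw [Algebra.smul_def]; ring

theorem psi_apply {F K : Type} [Field F] [Field K] [Algebra F K] {n : ℕ} (θ : K) 
    (v : (Fin n → F) × (Fin n → F)) (i : Fin n) :
    psiMap n θ v i = algebraMap F K (v.1 i) + algebraMap F K (v.2 i) * θ := rfl

theorem psi_zero_iff {F K : Type} [Field F] [Field K] [Algebra F K] {n : ℕ} {θ : K} 
    (hθ : ∀ a : F, algebraMap F K a ≠ θ) (v : (Fin n → F) × (Fin n → F)) (i : Fin n) :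
    psiMap n θ v i = 0 ↔ (v.1 i = 0 ∧ v.2 i = 0) := by
  rw [psi_apply]
  constructor
  · intro h
    have h2 : v.2 i = 0 := by
      by_contra hne
      apply hθ (- v.1 i / v.2 i)
      have : algebraMap F K (v.2 i) ≠ 0 := by simpa using hne
      rw [map_div₀, map_neg, div_eq_iff this]
      linear_combination -h
    rw [h2] at h
    simp at h
    exact ⟨h, h2⟩
  · rintro ⟨h1, h2⟩
    simp [h1, h2]

theorem psi_symp {F K : Type} [Field F] [Field K] [Algebra F K] {n : ℕ} (θ : K) 
    (σ : K →ₐ[F] K) (u v : (Fin n → F) × (Fin n → F)) :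
    algebraMap F K (sympB F n u v) * (σ θ - θ) =
      ∑ i, psiMap n θ v i * σ (psiMap n θ u i) - ∑ i, psiMap n θ u i * σ (psiMap n θ v i) := by
  rw [sympB_apply, map_sum, Finset.sum_mul, ← Finset.sum_sub_distrib]
  refine Finset.sum_congr rfl fun i _ => ?_
  simp only [psi_apply, map_sub, map_mul, map_add, AlgHom.commutes]
  ring

open Polynomial in
set_option maxHeartbeats 1000000 in
theorem rs_code (p : ℕ) (hp : p.Prime) (F : Type) [Field F] [Fintype F] [CharP F p]
    (δ n : ℕ) (hn : n = Fintype.card F ^ 2 - 1) (hδ : δ + 1 < Fintype.card F) :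
    ∃ D : Submodule F ((Fin n → F) × (Fin n → F)), Module.finrank F D = 2 * δ ∧
      D ≤ (sympB F n).orthogonal D ∧
      (∀ v ∈ (sympB F n).orthogonal D, v ≠ 0 → δ + 1 ≤ swt v) ∧
      (∀ v ∈ (sympB F n).orthogonal D, δ + 1 < swt v →
        ∃ z ∈ (sympB F n).orthogonal D, swt z ≤ δ + 1 ∧ swt (v - z) < swt v) := by
  classical
  obtain ⟨K, _, _, _, hK, hfin⟩ := exists_quad p hp F
  have hR : (sympB F n).IsRefl := (sympB_isAlt F n).isRefl
  -- the element θ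
  let σ : K →ₐ[F] K := FiniteField.frobeniusAlgHom F K
  have hσ : ∀ x, σ x = x ^ Fintype.card F := fun x => rfl
  have hσσ : ∀ x, σ (σ x) = x := fun x => by
    rw [hσ, hσ, ← pow_mul, ← pow_two, ← hK, FiniteField.pow_card]
  obtain ⟨θ, hθ⟩ : ∃ θ : K, σ θ ≠ θ := by
    by_contra! h
    have hq : 1 < Fintype.card F := by omega
    have := Polynomial.card_roots' (X ^ Fintype.card F - X : K[X])
    rw [FiniteField.X_pow_card_sub_X_natDegree_eq K hq] at this
    have h2 := Polynomial.card_le_degree_of_subset_roots (p := (X ^ Fintype.card F - X : K[X]))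
      (Z := Finset.univ) (by
        intro x _
        rw [mem_roots (FiniteField.X_pow_card_sub_X_ne_zero K hq)]
        have := h x
        rw [hσ] at this
        simp [this])
    rw [FiniteField.X_pow_card_sub_X_natDegree_eq K hq, Finset.card_univ, hK] at h2
    nlinarith
  have hθF : ∀ a : F, algebraMap F K a ≠ θ := by
    rintro a rfl
    exact hθ (σ.commutes a)
  have hinj : Function.Injective (psiMap n θ : ((Fin n → F) × (Fin n → F)) →ₗ[F] (Fin n → K)) := by
    rw [← LinearMap.ker_eq_bot, LinearMap.ker_eq_bot']
    intro v hv
    have h := fun i => (psi_zero_iff hθF v i).1 (congrFun hv i)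
    exact Prod.ext (funext fun i => (h i).1) (funext fun i => (h i).2)
  have hsurj : Function.Surjective
      (psiMap n θ : ((Fin n → F) × (Fin n → F)) →ₗ[F] (Fin n → K)) := by
    apply (LinearMap.injective_iff_surjective_of_finrank_eq_finrank ?_).1 hinj
    simp [Module.finrank_pi_fintype, hfin]; omega
  obtain ⟨e⟩ : Nonempty (Fin n ≃ Kˣ) := by
    rw [← Fintype.card_eq, Fintype.card_fin, Fintype.card_units, hK, hn]
  let E : ((Fin n → F) × (Fin n → F)) ≃ₗ[F] (Fin n → K) := LinearEquiv.ofBijective _ ⟨hinj, hsurj⟩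
  let ev : degreeLT K δ →ₗ[F] (Fin n → K) :=
    { toFun := fun g i => (e i : K) * (g : K[X]).eval (e i : K)
      map_add' := fun g h => by funext i; simp [mul_add]
      map_smul' := fun a g => by funext i; simp }
  have hev : ∀ g i, ev g i = (e i : K) * (g : K[X]).eval (e i : K) := fun _ _ => rfl
  have hevinj : Function.Injective ev := by
    rw [← LinearMap.ker_eq_bot, LinearMap.ker_eq_bot']
    intro g hg
    apply Subtype.ext
    apply Polynomial.eq_zero_of_degree_lt_of_eval_index_eq_zero (s := Finset.univ)
      (v := fun i => (e i : K)) (fun a _ b _ h => e.injective (Units.ext h))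
    · refine (mem_degreeLT.1 g.2).trans_le ?_
      rw [Finset.card_univ, Fintype.card_fin]
      have : δ ≤ n := by
        have : Fintype.card F ≤ Fintype.card F ^ 2 := Nat.le_self_pow (by norm_num) _
        omega
      exact_mod_cast this
    · intro i _
      have := congrFun hg i
      rw [hev] at this
      simpa using this
  let D : Submodule F ((Fin n → F) × (Fin n → F)) := (LinearMap.range ev).comap (psiMap n θ)
  have hDmem : ∀ v, v ∈ D ↔ ∃ g : K[X], g.degree < δ ∧
      ∀ i, psiMap n θ v i = (e i : K) * g.eval (e i : K) := by
    intro v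
    simp only [D, Submodule.mem_comap, LinearMap.mem_range]
    constructor
    · rintro ⟨g, hg⟩
      exact ⟨g, mem_degreeLT.1 g.2, fun i => by rw [← hg, hev]⟩
    · rintro ⟨g, hg, h⟩
      exact ⟨⟨g, mem_degreeLT.2 hg⟩, funext fun i => by rw [hev, h]⟩
  have hDfin : Module.finrank F D = 2 * δ := by
    have h1 : Module.finrank F D = Module.finrank F (LinearMap.range ev) :=
      (LinearEquiv.ofSubmodule' E (LinearMap.range ev)).finrank_eq
    rw [h1, LinearMap.finrank_range_of_inj hevinj, ← Module.finrank_mul_finrank F K, hfin,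
      (degreeLTEquiv K δ).finrank_eq]
    simp
  have hort : ∀ v, v ∈ (sympB F n).orthogonal D ↔ ∀ g : K[X], g.degree < δ →
      ∑ i, psiMap n θ v i * σ ((e i : K) * g.eval (e i : K)) = 0 := by
    intro v
    constructor
    · intro hv g hg
      have main : ∀ c : K, σ c * ∑ i, psiMap n θ v i * σ ((e i : K) * g.eval (e i : K)) =
          c * ∑ i, ((e i : K) * g.eval (e i : K)) * σ (psiMap n θ v i) := by
        intro c
        obtain ⟨u, hu⟩ := hsurj (fun i => (e i : K) * (C c * g).eval (e i : K))
        have huD : u ∈ D := (hDmem u).2 ⟨C c * g, by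
          by_cases hc : c = 0
          · simpa [hc] using WithBot.bot_lt_coe δ
          · rwa [degree_C_mul hc], fun i => by rw [hu]⟩
        have h0 : sympB F n u v = 0 := hv u huD
        have := psi_symp θ σ u v
        rw [h0, hu, map_zero, zero_mul, eq_comm, sub_eq_zero] at this
        rw [Finset.mul_sum, Finset.mul_sum]
        convert this using 2 with i _ i _
        · simp only [eval_mul, eval_C, map_mul]; ring
        · simp only [eval_mul, eval_C]; ring
      have m1 := main 1
      have m2 := main θ
      rw [map_one, one_mul, one_mul] at m1
      rw [← m1, ← sub_eq_zero, ← sub_mul] at m2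
      exact (mul_eq_zero.1 m2).resolve_left (sub_ne_zero.2 hθ)
    · intro hv u hu
      obtain ⟨g, hg, hug⟩ := (hDmem u).1 hu
      have h1 := psi_symp θ σ u v
      have h2 := hv g hg
      simp_rw [← hug] at h2
      have h3 : ∑ i, psiMap n θ u i * σ (psiMap n θ v i) = 0 := by
        have := congrArg σ h2
        rw [map_sum, map_zero] at this
        rw [← this]
        refine Finset.sum_congr rfl fun i _ => ?_
        rw [map_mul, hσσ, mul_comm]
      rw [h2, h3, sub_zero] at h1
      simpa [sub_ne_zero.2 hθ] using h1
  have hswt := swt_eq (psiMap n θ) (fun v i => psi_zero_iff hθF v i)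
  refine ⟨D, hDfin, ?_, ?_, ?_⟩
  · intro v hv
    obtain ⟨g, hg, hvg⟩ := (hDmem v).1 hv
    rw [hort]
    intro h hh
    simp_rw [hvg, hσ]
    exact rs_selforth (Fintype.card F) δ n hK hδ e g h hg hh
  · intro v hv hv0
    rw [hswt]
    refine rs_dist δ n σ.toRingHom e e.injective _ ?_ ((hort v).1 hv)
    intro h
    exact hv0 (hinj (h.trans (map_zero _).symm))
  · intro v hv hlt
    rw [hswt] at hlt
    set S : Finset (Fin n) := Finset.univ.filter (fun i => psiMap n θ v i ≠ 0) with hS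
    have hSc : {i | psiMap n θ v i ≠ 0}.ncard = S.card := by
      rw [← Set.ncard_coe_finset]; congr 1; ext; simp [hS]
    rw [hSc] at hlt
    obtain ⟨A, hAS, hA⟩ := Finset.exists_subset_card_eq hlt.le
    obtain ⟨j, hj⟩ := Finset.card_pos.1 (by omega : 0 < A.card)
    obtain ⟨z', hz1, hz2, hz3⟩ := rs_min δ n σ.toRingHom e e.injective A hA j hj (psiMap n θ v j)
    obtain ⟨z, rfl⟩ := hsurj z'
    refine ⟨z, (hort z).2 hz3, ?_, ?_⟩
    · rw [hswt, ← hA, ← Set.ncard_coe_finset]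
      refine Set.ncard_le_ncard ?_ (Set.toFinite _)
      intro i hi
      by_contra h
      exact hi (hz2 i h)
    · rw [hswt, hswt, hSc]
      have hlt2 : (S.erase j).card < S.card := Finset.card_erase_lt_of_mem (hAS hj)
      refine lt_of_le_of_lt ?_ hlt2
      rw [← Set.ncard_coe_finset]
      refine Set.ncard_le_ncard ?_ (Set.toFinite _)
      intro i hi
      simp only [map_sub, Pi.sub_apply, Set.mem_ofPred_eq] at hi
      simp only [Finset.coe_erase, Set.mem_diff, Set.mem_singleton_iff, Finset.mem_coe]
      constructor
      · by_contra h
        have hv0 : psiMap n θ v i = 0 := by simpa [hS] using h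
        exact hi (by rw [hv0, hz2 i (fun h' => h (hAS h')), sub_zero])
      · rintro rfl
        exact hi (by rw [hz1, sub_self])

/-- A family of MDS subsystem codes from Reed-Solomon codes.
For every prime power `q` and all `0 ≤ δ < q − 1` and `0 ≤ r < q^2 − 2δ − 1`,
there exists a pure `F_q`-linear MDS Clifford subsystem code with parameters
`[[q^2 − 1, q^2 − 2δ − 1 − r, r, δ + 1]]_q`. -/
theorem mds_subsystem_codes_from_rs_codes
    (p : ℕ) (hp : p.Prime) (F : Type) [Field F] [Fintype F] [CharP F p]
    (δ r : ℕ) (hδ : δ < Fintype.card F - 1)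
    (hr : r < Fintype.card F ^ 2 - 2 * δ - 1) :
    ∃ C : AddSubgroup ((Fin (Fintype.card F ^ 2 - 1) → F) ×
        (Fin (Fintype.card F ^ 2 - 1) → F)),
      IsSubsysCode p C (Fintype.card F ^ (Fintype.card F ^ 2 - 2 * δ - 1 - r))
        (Fintype.card F ^ r) (δ + 1) ∧
      FqLinear C ∧ PureTo C (δ + 1) ∧
      (Fintype.card F ^ 2 - 2 * δ - 1 - r) + r + 2 * (δ + 1) =
        (Fintype.card F ^ 2 - 1) + 2 := by
  obtain ⟨n, hn⟩ : ∃ n, n = Fintype.card F ^ 2 - 1 := ⟨_, rfl⟩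
  obtain ⟨q, hq⟩ : ∃ q, q = Fintype.card F := ⟨_, rfl⟩
  have hlin : (Fintype.card F ^ 2 - 2 * δ - 1 - r) + r = n - 2 * δ := by omega
  have hlin2 : 2 * δ + 1 + r + 1 ≤ Fintype.card F ^ 2 := by omega
  obtain ⟨k, hk⟩ : ∃ k, k = Fintype.card F ^ 2 - 2 * δ - 1 - r := ⟨_, rfl⟩
  have hk1 : k + r + 2 * δ = n := by omega
  have hk2 : 1 ≤ k := by omega
  obtain ⟨D, hD1, hD2, hD3, hD4⟩ := rs_code p hp F δ n hn (by omega)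
  have hV : Module.finrank F ((Fin n → F) × (Fin n → F)) = 2 * n := by simp; omega
  have hB := sympB_nondeg F n
  obtain ⟨C, hC1, hC2, hC3, hC4⟩ := symp_ext (sympB F n) hB (sympB_isAlt F n) D hD2 r
    (by omega)
  have hort := LinearMap.BilinForm.finrank_orthogonal hB D
  rw [← hk, ← hn]
  have hDs : ((C.toAddSubgroup : Set ((Fin n → F) × (Fin n → F))) ∩
      sympDual p (C.toAddSubgroup : Set ((Fin n → F) × (Fin n → F)))) =
      (D : Set ((Fin n → F) × (Fin n → F))) := by
    rw [Submodule.coe_toAddSubgroup, sympDual_eq p hp, ← hC3]; rfl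
  have hcard : ∀ W : Submodule F ((Fin n → F) × (Fin n → F)),
      Nat.card W = Fintype.card F ^ Module.finrank F W := by
    intro W
    rw [Module.natCard_eq_pow_finrank (K := F), Nat.card_eq_fintype_card]
  have hnle : ¬ (sympB F n).orthogonal D ≤ C := fun h => by
    have := Submodule.finrank_mono h
    omega
  refine ⟨C.toAddSubgroup, ?_, fun a v hv => C.smul_mem a hv, fun v hv => hD3 v (hC2 hv), by omega⟩
  unfold IsSubsysCode
  simp only [hDs]
  simp only [sympDual_eq p hp D, Submodule.coe_toAddSubgroup]
  refine ⟨?_, ?_, ?_, ?_⟩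
  · have : Nat.card (D : Set ((Fin n → F) × (Fin n → F))) = _ := hcard D
    rw [this, hD1, ← pow_add, ← pow_add]
    congr 1; omega
  · have : Nat.card C.toAddSubgroup = _ := hcard C
    rw [this, hC4, hD1, ← pow_add, ← pow_add]
    congr 1; omega
  · intro h
    exact absurd (le_of_eq (SetLike.coe_injective h)) hnle
  · intro _
    have hex : ∃ m, ∃ v, v ∈ (sympB F n).orthogonal D ∧ v ∉ C ∧ swt v = m := by
      obtain ⟨v, hv, hvC⟩ := Set.not_subset.1 hnle
      exact ⟨_, v, hv, hvC, rfl⟩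
    classical
    obtain ⟨v, hv, hvC, hvm⟩ := Nat.find_spec hex
    have hmin : ∀ w, w ∈ (sympB F n).orthogonal D → w ∉ C → swt v ≤ swt w := by
      intro w hw hwC
      rw [hvm]
      exact Nat.find_min' hex ⟨w, hw, hwC, rfl⟩
    have hne : ∀ w, w ∉ C → w ≠ 0 := fun w hw h => hw (h ▸ C.zero_mem)
    have hle : swt v ≤ δ + 1 := by
      by_contra hlt
      obtain ⟨z, hz, hz1, hz2⟩ := hD4 v hv (by omega)
      have hzC : z ∈ C := by
        by_contra h
        have := hmin z hz h
        omega
      have := hmin (v - z) (Submodule.sub_mem _ hv hz) (fun h => hvC (by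
        have := C.add_mem h hzC
        rwa [sub_add_cancel] at this))
      omega
    have heq : swt v = δ + 1 := le_antisymm hle (hD3 v hv (hne v hvC))
    unfold minSwt
    apply le_antisymm
    · refine le_csInf ⟨_, v, ⟨⟨hv, hvC⟩, hne v hvC⟩, rfl⟩ ?_
      rintro _ ⟨w, ⟨⟨hw, _⟩, hw0⟩, rfl⟩
      exact hD3 w hw hw0
    · refine Nat.sInf_le ⟨v, ⟨⟨hv, hvC⟩, hne v hvC⟩, heq⟩
end
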